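/- Let k be an algebraically closed field of characteristic p. Every F-space N^λ_k (for λ ∈ ℚ) is simple, i.e., has no nonzero proper F-stable L-subspaces; and every F-space over k is isomorphic to a finite direct sum ⊕_λ (N^λ_k)^{m_λ} with uniquely determined multiplicities m_λ (Manin–Dieudonné classification). -/

import Mathlib

/-- The Frobenius automorphism of `L = Frac(W(k))`. -/
noncomputable def fracWittFrobenius (p : ℕ) [Fact p.Prime] (k : Type*) [Field k] [CharP k p]
    [PerfectRing k p] :
    FractionRing (WittVector p k) ≃+* FractionRing (WittVector p k) :=
  IsFractionRing.ringEquivOfRingEquiv (WittVector.frobeniusEquiv p k)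

/-- The slope-`s/r` F-space `N^λ_k = (L[ξ], F_s)` on coordinates in the basis
`ξ^0, …, ξ^{r−1}`: `F(e_i) = p^{⌊(i+s)/r⌋} e_{(i+s) mod r}`, applied `σ`-semilinearly. -/
noncomputable def slopeFrob (p : ℕ) [Fact p.Prime] (k : Type*) [Field k] [CharP k p]
    [PerfectRing k p] (r : ℕ) (s : ℤ)
    (a : Fin r → FractionRing (WittVector p k)) :
    Fin r → FractionRing (WittVector p k) := fun j =>
  (p : FractionRing (WittVector p k)) ^ ((((j : ℤ) - s).emod r + s).ediv r) *
    fracWittFrobenius p k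
      (a ⟨(((j : ℤ) - s).emod r).toNat, by
        have h1 : 0 ≤ ((j : ℤ) - s).emod r :=
          Int.emod_nonneg _ (Int.natCast_ne_zero.mpr j.pos.ne')
        have h2 : ((j : ℤ) - s).emod r < r :=
          Int.emod_lt_of_pos _ (by exact_mod_cast j.pos)
        omega⟩)

/-- The simple F-space `N^λ_k` attached to a rational number `λ` (in lowest terms). -/
noncomputable abbrev Nlam (p : ℕ) [Fact p.Prime] (k : Type*) [Field k] [CharP k p]
    [PerfectRing k p] (lam : ℚ)
    (a : Fin lam.den → FractionRing (WittVector p k)) :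
    Fin lam.den → FractionRing (WittVector p k) :=
  slopeFrob p k lam.den lam.num a


set_option linter.unusedSectionVars false

namespace DM

open Finset

section ordsec

variable {p : ℕ} [Fact p.Prime] {k : Type*} [Field k] [IsAlgClosed k] [CharP k p]

/-- The fraction field. -/
local notation "LL" => FractionRing (WittVector p k)
/-- The Witt vectors. -/
local notation "WW" => WittVector p k

theorem pne : (p : LL) ≠ 0 := WittVector.FractionRing.p_nonzero p k

theorem sigma_alg (w : WW) : fracWittFrobenius p k (algebraMap WW LL w) =
    algebraMap WW LL (WittVector.frobenius w) := by
  simp [fracWittFrobenius]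

theorem sigma_p : fracWittFrobenius p k (p : LL) = p := by simp

theorem sigma_zpow (m : ℤ) : fracWittFrobenius p k ((p : LL) ^ m) = (p : LL) ^ m := by
  simp

theorem alg_inj : Function.Injective (algebraMap WW LL) := IsFractionRing.injective _ _

theorem exists_dec (x : LL) (hx : x ≠ 0) :
    ∃ m : ℤ, ∃ u : WW, u.coeff 0 ≠ 0 ∧ x = (p : LL) ^ m * algebraMap WW LL u := by
  obtain ⟨a, b, hb, rfl⟩ := IsFractionRing.div_surjective (A := WW) x
  have hb0 : b ≠ 0 := mem_nonZeroDivisors_iff_ne_zero.1 hb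
  have ha0 : a ≠ 0 := by rintro rfl; simp at hx
  obtain ⟨m, u, hu, rfl⟩ := WittVector.exists_eq_pow_p_mul a ha0
  obtain ⟨n, w, hw, rfl⟩ := WittVector.exists_eq_pow_p_mul b hb0
  obtain ⟨w', rfl⟩ := WittVector.isUnit_of_coeff_zero_ne_zero w hw
  refine ⟨m - n, u * (w'⁻¹ : WWˣ), ?_, ?_⟩
  · rw [WittVector.mul_coeff_zero]
    refine mul_ne_zero hu ?_
    have h1 : (w'.1 * (w'⁻¹ : WWˣ).1).coeff 0 = 1 := by simp
    rw [WittVector.mul_coeff_zero] at h1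
    exact right_ne_zero_of_mul_eq_one h1
  · have h2 : algebraMap WW LL w'.1 ≠ 0 := by
      intro h; rw [map_eq_zero_iff _ alg_inj] at h; exact w'.ne_zero h
    have h1 : algebraMap WW LL w'.1 * algebraMap WW LL (w'⁻¹ : WWˣ).1 = 1 := by
      rw [← map_mul]; simp
    have hp := pne (p := p) (k := k)
    rw [zpow_sub₀ hp]
    simp only [map_mul, map_pow, map_natCast, zpow_natCast]
    rw [div_eq_iff (mul_ne_zero (pow_ne_zero _ hp) h2)]
    field_simp
    linear_combination (-algebraMap WW LL u) * h1

open Classical in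
/-- The p-adic order, with junk value 0 at 0. -/
noncomputable def ord (x : LL) : ℤ := if h : x ≠ 0 then (exists_dec x h).choose else 0

theorem ord_spec (x : LL) (hx : x ≠ 0) :
    ∃ u : WW, u.coeff 0 ≠ 0 ∧ x = (p : LL) ^ (ord x) * algebraMap WW LL u := by
  rw [ord, dif_pos hx]; exact (exists_dec x hx).choose_spec

theorem dec_le (m n : ℤ) (u w : WW) (hu : u.coeff 0 ≠ 0)
    (h : (p : LL) ^ m * algebraMap WW LL u = (p : LL) ^ n * algebraMap WW LL w) : n ≤ m := by
  by_contra hlt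
  push Not at hlt
  obtain ⟨d, hd⟩ : ∃ d : ℕ, n = m + (d + 1 : ℕ) := ⟨(n - m - 1).toNat, by omega⟩
  rw [hd, zpow_add₀ pne, mul_assoc] at h
  have h2 := mul_left_cancel₀ (zpow_ne_zero m pne) h
  have h3 : u = (p : WW) ^ (d + 1) * w := by
    apply alg_inj (p := p) (k := k)
    rw [h2, map_mul, map_pow, map_natCast, zpow_natCast]
  apply hu
  rw [← WittVector.mem_span_p_iff_coeff_zero_eq_zero, Ideal.mem_span_singleton, h3, pow_succ']
  exact ⟨p ^ d * w, by ring⟩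

theorem alg_ne_zero {u : WW} (hu : u.coeff 0 ≠ 0) : algebraMap WW LL u ≠ 0 := by
  intro h
  rw [map_eq_zero_iff _ alg_inj] at h
  exact hu (by simp [h])

theorem ord_eq (m : ℤ) (u : WW) (hu : u.coeff 0 ≠ 0) :
    ord ((p : LL) ^ m * algebraMap WW LL u) = m := by
  obtain ⟨w, hw, h⟩ := ord_spec ((p : LL) ^ m * algebraMap WW LL u)
    (mul_ne_zero (zpow_ne_zero m pne) (alg_ne_zero hu))
  exact le_antisymm (dec_le _ _ _ _ hu h) (dec_le _ _ _ _ hw h.symm)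

theorem ord_mul {x y : LL} (hx : x ≠ 0) (hy : y ≠ 0) : ord (x * y) = ord x + ord y := by
  obtain ⟨u, hu, h⟩ := ord_spec x hx
  obtain ⟨w, hw, h'⟩ := ord_spec y hy
  have : x * y = (p : LL) ^ (ord x + ord y) * algebraMap WW LL (u * w) := by
    rw [zpow_add₀ pne, map_mul]
    conv_lhs => rw [h, h']
    ring
  rw [this, ord_eq]
  rw [WittVector.mul_coeff_zero]; exact mul_ne_zero hu hw

theorem ord_zpow (m : ℤ) : ord ((p : LL) ^ m) = m := by
  have := ord_eq (p := p) (k := k) m 1 (by simp)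
  simpa using this

theorem ord_sigma {x : LL} (hx : x ≠ 0) : ord (fracWittFrobenius p k x) = ord x := by
  obtain ⟨u, hu, h⟩ := ord_spec x hx
  conv_lhs => rw [h]
  rw [map_mul, sigma_zpow, sigma_alg, ord_eq]
  rw [WittVector.coeff_frobenius_charP]
  exact pow_ne_zero _ hu

theorem le_ord_of_eq {x : LL} (hx : x ≠ 0) (m : ℤ) (w : WW)
    (h : x = (p : LL) ^ m * algebraMap WW LL w) : m ≤ ord x := by
  obtain ⟨u, hu, h'⟩ := ord_spec x hx
  exact dec_le _ _ _ _ hu (h'.symm.trans h)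

theorem eq_of_le_ord {x : LL} (m : ℤ) (h : x = 0 ∨ m ≤ ord x) :
    ∃ w : WW, x = (p : LL) ^ m * algebraMap WW LL w := by
  by_cases hx : x = 0
  · exact ⟨0, by simp [hx]⟩
  have h := h.resolve_left hx
  obtain ⟨u, hu, h'⟩ := ord_spec x hx
  obtain ⟨d, hd⟩ : ∃ d : ℕ, ord x = m + d := ⟨(ord x - m).toNat, by omega⟩
  refine ⟨p ^ d * u, ?_⟩
  rw [hd, zpow_add₀ pne] at h'
  rw [h']; simp [mul_assoc]

theorem ord_add {x y : LL} (m : ℤ) (hx : x = 0 ∨ m ≤ ord x) (hy : y = 0 ∨ m ≤ ord y) :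
    x + y = 0 ∨ m ≤ ord (x + y) := by
  by_cases h : x + y = 0
  · exact Or.inl h
  right
  obtain ⟨u, hu⟩ := eq_of_le_ord m hx
  obtain ⟨w, hw⟩ := eq_of_le_ord m hy
  apply le_ord_of_eq h m (u + w)
  rw [map_add, mul_add, ← hu, ← hw]

theorem ord_neg (x : LL) : ord (-x) = ord x := by
  by_cases hx : x = 0
  · simp [hx]
  obtain ⟨u, hu, h⟩ := ord_spec x hx
  have : -x = (p : LL) ^ (ord x) * algebraMap WW LL (-u) := by
    rw [map_neg, mul_neg, ← h]
  rw [this, ord_eq]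
  intro h0
  apply hu
  have h1 := WittVector.mul_coeff_zero (-1 : WW) (-u)
  simpa [h0] using h1

/-- Elements with `t ≤ r * ord x`. -/
noncomputable def VV (p : ℕ) [Fact p.Prime] (k : Type*) [Field k] [IsAlgClosed k] [CharP k p]
    (r : ℕ) (t : ℤ) : AddSubgroup (FractionRing (WittVector p k)) where
  carrier := {x | x = 0 ∨ t ≤ r * ord x}
  zero_mem' := Or.inl rfl
  neg_mem' := by
    intro x hx
    simpa [ord_neg] using hx
  add_mem' := by
    intro x y hx hy
    by_cases hx0 : x = 0
    · simpa [hx0] using hy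
    by_cases hy0 : y = 0
    · simpa [hy0] using hx
    have hx := hx.resolve_left hx0
    have hy := hy.resolve_left hy0
    rcases ord_add (x := x) (y := y) (min (ord x) (ord y)) (Or.inr (min_le_left _ _))
      (Or.inr (min_le_right _ _)) with h | h
    · exact Or.inl h
    · right
      have h1 : (r : ℤ) * min (ord x) (ord y) ≤ r * ord (x + y) :=
        mul_le_mul_of_nonneg_left h (by positivity)
      rcases min_choice (ord x) (ord y) with h2 | h2 <;> rw [h2] at h1 <;> linarith

theorem mem_VV {r : ℕ} {t : ℤ} {x : LL} : x ∈ VV p k r t ↔ x = 0 ∨ t ≤ r * ord x := Iff.rfl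

theorem VV_mono {r : ℕ} {t u : ℤ} (h : t ≤ u) {x : LL} (hx : x ∈ VV p k r u) :
    x ∈ VV p k r t := by
  rcases hx with h0 | h0
  · exact Or.inl h0
  · exact Or.inr (h.trans h0)

theorem VV_mul {r : ℕ} {t u : ℤ} {x y : LL} (hx : x ∈ VV p k r t) (hy : y ∈ VV p k r u) :
    x * y ∈ VV p k r (t + u) := by
  by_cases hx0 : x = 0
  · left; simp [hx0]
  by_cases hy0 : y = 0
  · left; simp [hy0]
  right
  rw [ord_mul hx0 hy0]
  have hx := hx.resolve_left hx0
  have hy := hy.resolve_left hy0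
  linarith [mul_add (r : ℤ) (ord x) (ord y)]

theorem VV_sigma {r : ℕ} {t : ℤ} {x : LL} (hx : x ∈ VV p k r t) :
    fracWittFrobenius p k x ∈ VV p k r t := by
  by_cases hx0 : x = 0
  · left; simp [hx0]
  right
  rw [ord_sigma hx0]
  exact hx.resolve_left hx0

theorem VV_sigma_iter {r : ℕ} {t : ℤ} {x : LL} (hx : x ∈ VV p k r t) (j : ℕ) :
    (fracWittFrobenius p k)^[j] x ∈ VV p k r t := by
  induction j with
  | zero => exact hx
  | succ j ih => rw [Function.iterate_succ_apply']; exact VV_sigma ih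

theorem VV_zpow (r : ℕ) (m : ℤ) : (p : LL) ^ m ∈ VV p k r (r * m) := by
  right; rw [ord_zpow]

theorem VV_alg (r : ℕ) (w : WW) : algebraMap WW LL w ∈ VV p k r 0 := by
  by_cases hx0 : algebraMap WW LL w = 0
  · left; simp [hx0]
  right
  have := le_ord_of_eq hx0 0 w (by simp)
  positivity

theorem VV_alg_of_coeff (r : ℕ) {w : WW} (hw : w.coeff 0 = 0) :
    algebraMap WW LL w ∈ VV p k r r := by
  rw [← WittVector.mem_span_p_iff_coeff_zero_eq_zero, Ideal.mem_span_singleton] at hw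
  obtain ⟨c, rfl⟩ := hw
  have h := VV_mul (VV_zpow (p := p) (k := k) r 1) (VV_alg r c)
  simpa using h

theorem VV_one_coeff {r : ℕ} {w : WW} (h : algebraMap WW LL w ∈ VV p k r 1) :
    w.coeff 0 = 0 := by
  by_contra hw
  have h2 := h.resolve_left (alg_ne_zero hw)
  have h3 := ord_eq (p := p) (k := k) 0 w hw
  simp only [zpow_zero, one_mul] at h3
  rw [h3] at h2
  simp at h2

theorem VV_int {r : ℕ} (hr : 0 < r) {m : ℤ} {x : LL} (h : x ∈ VV p k r (r * m)) :
    ∃ w : WW, x = (p : LL) ^ m * algebraMap WW LL w := by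
  apply eq_of_le_ord
  rcases h with h | h
  · exact Or.inl h
  · right
    exact le_of_mul_le_mul_left h (by exact_mod_cast hr)

theorem VV_int0 {r : ℕ} (hr : 0 < r) {x : LL} (h : x ∈ VV p k r 0) :
    ∃ w : WW, x = algebraMap WW LL w := by
  have := VV_int hr (m := 0) (x := x) (by simpa using h)
  simpa using this

theorem VV_haus {r : ℕ} {t : ℤ} {x : LL} (h : ∀ m : ℕ, x ∈ VV p k r (t + m)) :
    x = 0 := by
  by_contra hx
  have h1 := (h (r * ord x - t + 1).toNat).resolve_left hx
  omega

theorem VV_complete {r : ℕ} (hr : 0 < r) (t : ℤ) (z : ℕ → LL)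
    (hz : ∀ i : ℕ, z i ∈ VV p k r (t + i)) :
    ∃ S : LL, ∀ m : ℕ, S - ∑ i ∈ range m, z i ∈ VV p k r (t + m) := by
  set q : ℤ := t / r with hq
  have hr' : (0 : ℤ) < r := by exact_mod_cast hr
  have hq1 : r * q ≤ t := Int.mul_ediv_self_le hr'.ne'
  have hq2 : t < r * q + r := by
    have := Int.lt_mul_ediv_self_add (x := t) hr'
    linarith
  have hy : ∀ i : ℕ, (p : LL) ^ (-q) * z i ∈ VV p k r i := fun i =>
    VV_mono (by linarith) (VV_mul (VV_zpow r (-q)) (hz i))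
  choose w hw using fun i => VV_int0 hr (VV_mono (by positivity) (hy i))
  have hwd : ∀ (i m : ℕ), r * m ≤ i → w i ∈ Ideal.span {(p : WW)} ^ m := by
    intro i m him
    rw [Ideal.span_singleton_pow, Ideal.mem_span_singleton]
    obtain ⟨c, hc⟩ := VV_int hr (m := m) (VV_mono (by exact_mod_cast him) (hy i))
    refine ⟨c, ?_⟩
    apply alg_inj (p := p) (k := k)
    rw [← hw, hc]; simp
  have hcomp := (WittVector.isAdicCompleteIdealSpanP (p := p) (k := k)).toIsPrecomplete.prec'
  obtain ⟨S0, hS0⟩ := hcomp (fun m => ∑ i ∈ range (r * m), w i) (by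
    intro m n hmn
    rw [SModEq.sub_mem, smul_eq_mul, Ideal.mul_top, ← neg_sub, neg_mem_iff,
      ← Finset.sum_Ico_eq_sub _ (Nat.mul_le_mul_left r hmn)]
    exact Ideal.sum_mem _ fun i hi => hwd i m (Finset.mem_Ico.1 hi).1)
  refine ⟨(p : LL) ^ q * algebraMap WW LL S0, fun m => ?_⟩
  have hzw : ∀ i, z i = (p : LL) ^ q * algebraMap WW LL (w i) := fun i => by
    rw [← hw, ← mul_assoc, ← zpow_add₀ pne]; simp
  have h1 := hS0 (m + 1)
  rw [SModEq.sub_mem, smul_eq_mul, Ideal.mul_top, Ideal.span_singleton_pow,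
    Ideal.mem_span_singleton] at h1
  obtain ⟨c, hc⟩ := h1
  have h2 : (p : LL) ^ q * algebraMap WW LL S0 - ∑ i ∈ range m, z i =
      (∑ i ∈ Ico m (r * (m + 1)), z i) - (p : LL) ^ (q + (m + 1 : ℕ)) * algebraMap WW LL c := by
    have hm : m ≤ r * (m + 1) := by nlinarith
    rw [Finset.sum_Ico_eq_sub _ hm]
    have h3 : ∑ i ∈ range (r * (m + 1)), z i =
        (p : LL) ^ q * algebraMap WW LL (∑ i ∈ range (r * (m + 1)), w i) := by
      rw [map_sum, Finset.mul_sum]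
      exact Finset.sum_congr rfl fun i _ => hzw i
    rw [h3, zpow_add₀ pne]
    have h4 := congrArg (algebraMap WW LL) hc
    rw [map_sub, map_mul, map_pow, map_natCast] at h4
    rw [zpow_natCast]
    linear_combination (-(p : LL) ^ q) * h4
  rw [h2]
  refine sub_mem (sum_mem fun i hi => VV_mono ?_ (hz i)) ?_
  · have := (Finset.mem_Ico.1 hi).1
    omega
  · refine VV_mono ?_ (VV_mul (VV_zpow r _) (VV_alg r c))
    push_cast
    nlinarith

end ordsec


section keysec

variable {p : ℕ} [Fact p.Prime] {k : Type*} [Field k] [IsAlgClosed k] [CharP k p]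

/-- The fraction field. -/
local notation "LL" => FractionRing (WittVector p k)
/-- The Witt vectors. -/
local notation "WW" => WittVector p k

/-- The twisted polynomial operator on quasi-periodic functions. -/
noncomputable def TT (n : ℕ) (s : ℤ) (b : ℕ → LL) (c : ℤ → LL) (t : ℤ) : LL :=
  ∑ j ∈ range (n + 1), b j * (fracWittFrobenius p k)^[j] (c (t - j * s))

/-- Quasi-periodic functions. -/
def QQ (r : ℕ) (c : ℤ → LL) : Prop := ∀ t, c (t + r) = p * c t

/-- Filtration on functions. -/
def Fil (r : ℕ) (m : ℤ) (c : ℤ → LL) : Prop := ∀ t, c t ∈ VV p k r (t + m)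

/-- Hypothesis on coefficients. -/
def Good (r : ℕ) (n : ℕ) (s : ℤ) (b : ℕ → LL) : Prop := ∀ j ≤ n, b j ∈ VV p k r (j * s)

theorem sigma_iter_p_mul (j : ℕ) (x : LL) :
    (fracWittFrobenius p k)^[j] (p * x) = p * (fracWittFrobenius p k)^[j] x := by
  induction j with
  | zero => rfl
  | succ j ih => rw [Function.iterate_succ_apply', ih, map_mul, sigma_p,
      ← Function.iterate_succ_apply' (f := fracWittFrobenius p k)]

theorem sigma_iter_zpow_mul (j : ℕ) (m : ℤ) (x : LL) :
    (fracWittFrobenius p k)^[j] ((p : LL) ^ m * x) =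
      (p : LL) ^ m * (fracWittFrobenius p k)^[j] x := by
  induction j with
  | zero => rfl
  | succ j ih => rw [Function.iterate_succ_apply', ih, map_mul, sigma_zpow,
      ← Function.iterate_succ_apply' (f := fracWittFrobenius p k)]

theorem sigma_iter_alg (j : ℕ) (w : WW) :
    (fracWittFrobenius p k)^[j] (algebraMap WW LL w) =
      algebraMap WW LL (WittVector.frobenius^[j] w) := by
  induction j with
  | zero => rfl
  | succ j ih => rw [Function.iterate_succ_apply', ih, sigma_alg,
      Function.iterate_succ_apply']

theorem frob_iter_coeff (j : ℕ) (w : WW) :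
    (WittVector.frobenius^[j] w).coeff 0 = w.coeff 0 ^ p ^ j := by
  induction j with
  | zero => simp
  | succ j ih => rw [Function.iterate_succ_apply', WittVector.coeff_frobenius_charP, ih,
      ← pow_mul, pow_succ]

theorem QQ_mul {r : ℕ} {c : ℤ → LL} (hc : QQ r c) (t m : ℤ) :
    c (t + r * m) = (p : LL) ^ m * c t := by
  induction m using Int.induction_on with
  | zero => simp
  | succ i ih =>
    have := hc (t + r * i)
    rw [show t + (r : ℤ) * (i + 1) = t + r * i + r by ring, this, ih, zpow_add₀ pne]
    simp; ring
  | pred i ih =>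
    have := hc (t + r * (-i - 1))
    rw [show t + (r : ℤ) * (-i - 1) + r = t + r * (-i) by ring, ih] at this
    rw [zpow_sub₀ pne, zpow_one]
    have hp := pne (p := p) (k := k)
    field_simp
    rw [this]; ring

theorem TT_sub (n : ℕ) (s : ℤ) (b : ℕ → LL) (c d : ℤ → LL) (t : ℤ) :
    TT n s b (fun t => c t - d t) t = TT n s b c t - TT n s b d t := by
  simp only [TT, ← Finset.sum_sub_distrib, iterate_map_sub, mul_sub]

theorem TT_QQ {r n : ℕ} {s : ℤ} {b : ℕ → LL} {c : ℤ → LL} (hc : QQ r c) :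
    QQ r (TT n s b c) := by
  intro t
  simp only [TT, Finset.mul_sum]
  refine Finset.sum_congr rfl fun j _ => ?_
  rw [show t + (r : ℤ) - j * s = t - j * s + r by ring, hc, sigma_iter_p_mul]
  ring

theorem TT_Fil {r n : ℕ} {s : ℤ} {b : ℕ → LL} (hb : Good r n s b) {c : ℤ → LL} {m : ℤ}
    (hc : Fil r m c) : Fil r m (TT n s b c) := by
  intro t
  refine sum_mem fun j hj => ?_
  have := VV_mul (hb j (by simpa [Nat.lt_succ_iff] using hj))
    (VV_sigma_iter (hc (t - j * s)) j)
  exact VV_mono (by linarith) this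

theorem TT_shift (n : ℕ) (s : ℤ) (b : ℕ → LL) (c : ℤ → LL) (t m : ℤ) :
    TT n s b (fun t => c (t + m)) t = TT n s b c (t + m) := by
  simp only [TT]
  refine Finset.sum_congr rfl fun j _ => ?_
  rw [show t - (j : ℤ) * s + m = t + m - j * s by ring]

/-- The basic quasi-periodic function. -/
noncomputable def cc (r : ℕ) (w : WW) (t : ℤ) : LL :=
  if (r : ℤ) ∣ t then (p : LL) ^ (t / r) * algebraMap WW LL w else 0

theorem cc_QQ {r : ℕ} (hr : 0 < r) (w : WW) : QQ r (cc (k := k) r w) := by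
  intro t
  have hr' : (r : ℤ) ≠ 0 := by exact_mod_cast hr.ne'
  by_cases h : (r : ℤ) ∣ t
  · have h' : (r : ℤ) ∣ t + r := dvd_add h dvd_rfl
    rw [cc, cc, if_pos h, if_pos h', Int.add_ediv_of_dvd_left h, Int.ediv_self hr',
      zpow_add₀ pne]
    simp; ring
  · have h' : ¬ (r : ℤ) ∣ t + r := by simpa using h
    rw [cc, cc, if_neg h, if_neg h']; simp

theorem cc_Fil (r : ℕ) (w : WW) : Fil r 0 (cc (k := k) r w) := by
  intro t
  by_cases h : (r : ℤ) ∣ t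
  · rw [cc, if_pos h]
    have := VV_mul (VV_zpow (p := p) (k := k) r (t / r)) (VV_alg r w)
    rwa [Int.mul_ediv_cancel' h] at this
  · rw [cc, if_neg h]; exact zero_mem _

theorem Fil_one {r : ℕ} {e : ℤ → LL} (h0 : Fil r 0 e) (hq : QQ r e)
    (h1 : e 0 ∈ VV p k r 1) : Fil r 1 e := by
  intro t
  by_cases h : (r : ℤ) ∣ t
  · obtain ⟨q, rfl⟩ := h
    have := QQ_mul hq 0 q
    rw [zero_add] at this
    rw [this]
    exact VV_mul (VV_zpow r q) h1
  · rcases h0 t with h2 | h2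
    · exact Or.inl h2
    · right
      have : t ≠ r * ord (e t) := fun h3 => h ⟨_, h3⟩
      rw [add_zero] at h2
      omega

/-- The residual coefficients. -/
theorem exists_beta {r n : ℕ} (hr : 0 < r) {s : ℤ} {b : ℕ → LL} (hb : Good r n s b) :
    ∃ β : ℕ → WW, (∀ w : WW, TT n s b (cc r w) 0 =
        algebraMap WW LL (∑ j ∈ range (n + 1), β j * WittVector.frobenius^[j] w)) ∧
      ∀ j ≤ n, b j ≠ 0 → r * ord (b j) = j * s → (β j).coeff 0 ≠ 0 := by
  have hr' : (r : ℤ) ≠ 0 := by exact_mod_cast hr.ne'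
  have key : ∀ j : ℕ, ∃ β : WW, j ≤ n →
      (if (r : ℤ) ∣ j * s then b j * (p : LL) ^ (-(j * s / r)) else 0) = algebraMap WW LL β := by
    intro j
    by_cases hj : j ≤ n
    · by_cases h : (r : ℤ) ∣ j * s
      · have h1 := VV_mul (hb j hj) (VV_zpow (p := p) (k := k) r (-(j * s / r)))
        rw [mul_neg, Int.mul_ediv_cancel' h, add_neg_cancel] at h1
        obtain ⟨w, hw⟩ := VV_int0 hr h1
        exact ⟨w, fun _ => by rw [if_pos h, hw]⟩
      · exact ⟨0, fun _ => by rw [if_neg h]; simp⟩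
    · exact ⟨0, fun h => absurd h hj⟩
  choose β hβ using key
  refine ⟨β, fun w => ?_, fun j hj hbj hord hc => ?_⟩
  · rw [TT, map_sum]
    refine Finset.sum_congr rfl fun j hj => ?_
    rw [map_mul, ← hβ j (by simpa [Nat.lt_succ_iff] using hj), zero_sub, cc]
    by_cases h : (r : ℤ) ∣ j * s
    · rw [if_pos h, if_pos (by simpa using h), sigma_iter_zpow_mul, sigma_iter_alg,
        Int.neg_ediv_of_dvd h]
      ring
    · rw [if_neg h, if_neg (by simpa using h)]
      simp
  · have h := hβ j hj
    have hd : (r : ℤ) ∣ j * s := ⟨_, hord.symm⟩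
    rw [if_pos hd] at h
    have h1 := VV_alg_of_coeff (p := p) (k := k) r hc
    rw [← h] at h1
    have h2 := h1.resolve_left (mul_ne_zero hbj (zpow_ne_zero _ pne))
    rw [ord_mul hbj (zpow_ne_zero _ pne), ord_zpow, mul_add, hord, mul_neg,
      Int.mul_ediv_cancel' hd] at h2
    omega

theorem alg_sum_coeff (n : ℕ) (β : ℕ → WW) (w : WW) :
    (∑ j ∈ range (n + 1), β j * WittVector.frobenius^[j] w).coeff 0 =
      ∑ j ∈ range (n + 1), (β j).coeff 0 * w.coeff 0 ^ p ^ j := by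
  have h : ∀ x : WW, x.coeff 0 = WittVector.constantCoeff x := fun x => rfl
  rw [h, map_sum]
  refine Finset.sum_congr rfl fun j _ => ?_
  rw [map_mul, ← h, ← h, frob_iter_coeff]

theorem root1 (n : ℕ) (β : ℕ → k) (δ : k) (h : ∃ j ≤ n, β j ≠ 0) :
    ∃ z : k, ∑ j ∈ range (n + 1), β j * z ^ p ^ j = δ := by
  obtain ⟨j0, hj0, hne⟩ := h
  have hp : 1 < p := (Fact.out : p.Prime).one_lt
  let P : Polynomial k := (∑ j ∈ range (n + 1), Polynomial.C (β j) * Polynomial.X ^ p ^ j)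
    - Polynomial.C δ
  have hc : P.coeff (p ^ j0) = β j0 := by
    simp only [P, Polynomial.coeff_sub, Polynomial.finsetSum_coeff, Polynomial.coeff_C_mul,
      Polynomial.coeff_X_pow, Polynomial.coeff_C]
    rw [if_neg (by positivity), Finset.sum_eq_single j0]
    · simp
    · intro b _ hb
      rw [if_neg, mul_zero]
      intro h
      exact hb (Nat.pow_right_injective hp h).symm
    · intro h; exfalso; apply h; simp; omega
  obtain ⟨z, hz⟩ := IsAlgClosed.exists_root P (by
    intro h
    have h2 := Polynomial.le_degree_of_ne_zero (n := p ^ j0) (p := P) (by rw [hc]; exact hne)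
    rw [h] at h2
    have h3 : p ^ j0 ≤ 0 := by exact_mod_cast h2
    have : 0 < p ^ j0 := by positivity
    omega)
  refine ⟨z, ?_⟩
  simp only [P, Polynomial.IsRoot.def, Polynomial.eval_sub, Polynomial.eval_finsetSum,
    Polynomial.eval_mul, Polynomial.eval_C, Polynomial.eval_pow, Polynomial.eval_X] at hz
  exact sub_eq_zero.1 hz

theorem root2 (n : ℕ) (β : ℕ → k) (h0 : β 0 ≠ 0) (h : ∃ j ≤ n, 0 < j ∧ β j ≠ 0) :
    ∃ z : k, z ≠ 0 ∧ ∑ j ∈ range (n + 1), β j * z ^ p ^ j = 0 := by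
  obtain ⟨j0, hj0, hpos, hne⟩ := h
  have hp : 1 < p := (Fact.out : p.Prime).one_lt
  have hpp : ∀ j, 0 < p ^ j := fun j => by positivity
  let P : Polynomial k := (∑ j ∈ range (n + 1), Polynomial.C (β j) * Polynomial.X ^ (p ^ j - 1))
  have hc : ∀ j0 ≤ n, P.coeff (p ^ j0 - 1) = β j0 := by
    intro j0 hj0
    simp only [P, Polynomial.finsetSum_coeff, Polynomial.coeff_C_mul,
      Polynomial.coeff_X_pow]
    rw [Finset.sum_eq_single j0]
    · simp
    · intro b _ hb
      rw [if_neg, mul_zero]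
      intro h
      have h1 := hpp j0
      have h2 := hpp b
      exact hb (Nat.pow_right_injective hp (show p ^ b = p ^ j0 by omega))
    · intro h; exfalso; apply h; simp; omega
  obtain ⟨z, hz⟩ := IsAlgClosed.exists_root P (by
    intro h
    have h2 := Polynomial.le_degree_of_ne_zero (n := p ^ j0 - 1) (p := P)
      (by rw [hc j0 hj0]; exact hne)
    rw [h] at h2
    have h3 : p ^ j0 - 1 ≤ 0 := by exact_mod_cast h2
    have : 1 < p ^ j0 := Nat.one_lt_pow hpos.ne' hp
    omega)
  refine ⟨z, ?_, ?_⟩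
  · rintro rfl
    rw [Polynomial.IsRoot.def, ← Polynomial.coeff_zero_eq_eval_zero] at hz
    have := hc 0 (Nat.zero_le _)
    simp only [pow_zero, Nat.sub_self] at this
    exact h0 (this.symm.trans hz)
  · simp only [P, Polynomial.IsRoot.def, Polynomial.eval_finsetSum,
      Polynomial.eval_mul, Polynomial.eval_C, Polynomial.eval_pow, Polynomial.eval_X] at hz
    rw [← mul_zero z, ← hz, Finset.mul_sum]
    refine Finset.sum_congr rfl fun j _ => ?_
    rw [mul_left_comm, ← pow_succ', Nat.sub_add_cancel (hpp j)]

theorem QQ_sub {r : ℕ} {c d : ℤ → LL} (hc : QQ r c) (hd : QQ r d) :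
    QQ r (fun t => c t - d t) := by
  intro t
  simp only [hc t, hd t, mul_sub]

theorem Fil_sub {r : ℕ} {m : ℤ} {c d : ℤ → LL} (hc : Fil r m c) (hd : Fil r m d) :
    Fil r m (fun t => c t - d t) := fun t => sub_mem (hc t) (hd t)

theorem step0 {r n : ℕ} (hr : 0 < r) {s : ℤ} {b : ℕ → LL} (hb : Good r n s b)
    (hu : ∃ j ≤ n, b j ≠ 0 ∧ r * ord (b j) = j * s) (d : ℤ → LL) (hd : QQ r d)
    (hd0 : Fil r 0 d) :
    ∃ c : ℤ → LL, QQ r c ∧ Fil r 0 c ∧ Fil r 1 (fun t => d t - TT n s b c t) := by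
  obtain ⟨β, hβ, hβ'⟩ := exists_beta hr hb
  obtain ⟨j0, hj0, hne, hord⟩ := hu
  obtain ⟨δ, hδ⟩ := VV_int0 hr (hd0 0)
  obtain ⟨z, hz⟩ := root1 (p := p) n (fun j => (β j).coeff 0) (δ.coeff 0)
    ⟨j0, hj0, hβ' j0 hj0 hne hord⟩
  let γ : WW := WittVector.teichmuller p z
  have hγ : γ.coeff 0 = z := WittVector.teichmuller_coeff_zero p z
  refine ⟨cc r γ, cc_QQ hr γ, cc_Fil r γ, ?_⟩
  refine Fil_one (Fil_sub hd0 (TT_Fil hb (cc_Fil r γ))) (QQ_sub hd (TT_QQ (cc_QQ hr γ))) ?_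
  rw [hδ, hβ, ← map_sub]
  refine VV_mono (by omega) (VV_alg_of_coeff r ?_)
  have h : ∀ x : WW, x.coeff 0 = WittVector.constantCoeff x := fun x => rfl
  rw [h, map_sub, ← h, ← h, alg_sum_coeff, hγ, hz, sub_self]

theorem stepm {r n : ℕ} (hr : 0 < r) {s : ℤ} {b : ℕ → LL} (hb : Good r n s b)
    (hu : ∃ j ≤ n, b j ≠ 0 ∧ r * ord (b j) = j * s) (m : ℤ) (d : ℤ → LL) (hd : QQ r d)
    (hd0 : Fil r m d) :
    ∃ c : ℤ → LL, QQ r c ∧ Fil r m c ∧ Fil r (m + 1) (fun t => d t - TT n s b c t) := by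
  obtain ⟨c, hc1, hc2, hc3⟩ := step0 hr hb hu (fun t => d (t - m))
    (fun t => by simpa [add_sub_right_comm] using hd (t - m))
    (fun t => by simpa using hd0 (t - m))
  refine ⟨fun t => c (t + m), fun t => ?_, fun t => ?_, fun t => ?_⟩
  · simpa [add_right_comm] using hc1 (t + m)
  · simpa using hc2 (t + m)
  · have := hc3 (t + m)
    simp only [add_sub_cancel_right, ← TT_shift] at this
    rwa [← add_assoc]

theorem TT_surj {r n : ℕ} (hr : 0 < r) {s : ℤ} {b : ℕ → LL} (hb : Good r n s b)
    (hu : ∃ j ≤ n, b j ≠ 0 ∧ r * ord (b j) = j * s) (m : ℤ) (d : ℤ → LL) (hd : QQ r d)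
    (hd0 : Fil r m d) :
    ∃ c : ℤ → LL, QQ r c ∧ Fil r m c ∧ ∀ t, TT n s b c t = d t := by
  choose! C hC1 hC2 hC3 using fun (m : ℤ) (d : ℤ → LL) (hd : QQ r d) (h : Fil r m d) =>
    stepm hr hb hu m d hd h
  let D : ℕ → (ℤ → LL) := fun i => Nat.rec d (fun i e => fun t => e t - TT n s b (C (m + i) e) t) i
  have hDs : ∀ i, D (i + 1) = fun t => D i t - TT n s b (C (m + i) (D i)) t := fun i => rfl
  have hD : ∀ i, QQ r (D i) ∧ Fil r (m + i) (D i) := by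
    intro i
    induction i with
    | zero =>
      refine ⟨hd, ?_⟩
      have h0 : Fil r (m + (0 : ℕ)) d := by simpa using hd0
      exact h0
    | succ i ih =>
      rw [hDs]
      refine ⟨QQ_sub ih.1 (TT_QQ (hC1 _ _ ih.1 ih.2)), ?_⟩
      have := hC3 _ _ ih.1 ih.2
      push_cast
      rwa [← add_assoc]
  let E : ℕ → ℤ → LL := fun i => C (m + i) (D i)
  have hE1 : ∀ i, QQ r (E i) := fun i => hC1 _ _ (hD i).1 (hD i).2
  have hE2 : ∀ i : ℕ, Fil r (m + i) (E i) := fun i => hC2 _ _ (hD i).1 (hD i).2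
  choose S hS using fun t : ℤ => VV_complete hr (t + m) (fun i => E i t)
    (fun i => by rw [add_assoc]; exact hE2 i t)
  have hSF : ∀ M : ℕ, Fil r (m + M) (fun t => S t - ∑ i ∈ range M, E i t) := fun M t => by
    rw [← add_assoc]; exact hS t M
  refine ⟨S, fun t => ?_, fun t => by simpa using hSF 0 t, fun t => ?_⟩
  · rw [← sub_eq_zero]
    refine VV_haus (r := r) (t := t + r + m) fun M => ?_
    have h1 := hS (t + r) M
    have h2 := VV_mul (VV_zpow (p := p) (k := k) r 1) (hS t M)
    have h3 : S (t + r) - p * S t = (S (t + r) - ∑ i ∈ range M, E i (t + r)) -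
        (p : LL) ^ (1 : ℤ) * (S t - ∑ i ∈ range M, E i t) := by
      have : ∑ i ∈ range M, E i (t + r) = p * ∑ i ∈ range M, E i t := by
        rw [Finset.mul_sum]
        exact Finset.sum_congr rfl fun i _ => hE1 i t
      rw [this, zpow_one]; ring
    rw [h3]
    exact sub_mem h1 (VV_mono (by linarith) h2)
  · have hDM : ∀ M : ℕ, ∀ t, D M t = d t - TT n s b (fun t => ∑ i ∈ range M, E i t) t := by
      intro M
      induction M with
      | zero => intro t; simp [D, TT]
      | succ M ih =>
        intro t
        rw [hDs]
        simp only [Finset.sum_range_succ]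
        have h5 := TT_sub n s b (fun t => ∑ i ∈ range M, E i t + E M t) (E M) t
        simp only [add_sub_cancel_right] at h5
        rw [ih, h5]
        simp only [E]
        ring
    rw [← sub_eq_zero]
    refine VV_haus (r := r) (t := t + m) fun M => ?_
    have h1 := TT_Fil hb (hSF M) t
    rw [TT_sub] at h1
    have h2 := (hD M).2 t
    rw [hDM] at h2
    have h3 := sub_mem h1 h2
    rw [← add_assoc] at h3
    convert h3 using 1
    ring

theorem TT_ker {r n : ℕ} (hr : 0 < r) {s : ℤ} {b : ℕ → LL} (hb : Good r n s b)
    (h0 : b 0 ≠ 0) (h0' : ord (b 0) = 0)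
    (hu : ∃ j ≤ n, 0 < j ∧ b j ≠ 0 ∧ r * ord (b j) = j * s) :
    ∃ c : ℤ → LL, QQ r c ∧ c 0 ≠ 0 ∧ ∀ t, TT n s b c t = 0 := by
  obtain ⟨β, hβ, hβ'⟩ := exists_beta hr hb
  obtain ⟨j0, hj0, hpos, hne, hord⟩ := hu
  obtain ⟨z, hz0, hz⟩ := root2 (p := p) n (fun j => (β j).coeff 0)
    (hβ' 0 (Nat.zero_le _) h0 (by simp [h0'])) ⟨j0, hj0, hpos, hβ' j0 hj0 hne hord⟩
  let γ : WW := WittVector.teichmuller p z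
  have hγ : γ.coeff 0 = z := WittVector.teichmuller_coeff_zero p z
  have hT : Fil r 1 (TT n s b (cc r γ)) := by
    refine Fil_one (TT_Fil hb (cc_Fil r γ)) (TT_QQ (cc_QQ hr γ)) ?_
    rw [hβ]
    refine VV_mono (by omega) (VV_alg_of_coeff r ?_)
    rw [alg_sum_coeff, hγ, hz]
  obtain ⟨c, hc1, hc2, hc3⟩ := TT_surj hr hb ⟨j0, hj0, hne, hord⟩ 1 _ (TT_QQ (cc_QQ hr γ)) hT
  refine ⟨fun t => cc r γ t - c t, QQ_sub (cc_QQ hr γ) hc1, ?_, fun t => ?_⟩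
  · intro h
    have h1 : cc r γ 0 = c 0 := sub_eq_zero.1 h
    have h2 := hc2 0
    rw [← h1, cc, if_pos (dvd_zero _)] at h2
    simp only [Int.zero_ediv, zpow_zero, one_mul, zero_add] at h2
    exact hz0 (hγ ▸ VV_one_coeff h2)
  · rw [TT_sub, hc3, sub_self]

/-- Surjectivity of `p^e1 σ^m - p^e0` on the fraction field. -/
theorem sigma_surj (m : ℕ) (hm : 0 < m) (e0 e1 : ℤ) (c : LL) :
    ∃ d : LL, (p : LL) ^ e1 * (fracWittFrobenius p k)^[m] d - (p : LL) ^ e0 * d = c := by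
  set e := min e0 e1 with he
  let b : ℕ → LL := fun j => if j = 0 then -(p : LL) ^ (e0 - e) else
    if j = m then (p : LL) ^ (e1 - e) else 0
  have hb0 : b 0 = -(p : LL) ^ (e0 - e) := if_pos rfl
  have hbm : b m = (p : LL) ^ (e1 - e) := by simp [b, hm.ne']
  have hpz : ∀ i : ℤ, (p : LL) ^ i ≠ 0 := fun i => zpow_ne_zero _ pne
  have hb : Good 1 m 0 b := by
    intro j _
    by_cases h0 : j = 0
    · subst h0
      rw [hb0]
      exact neg_mem (VV_mono (by simp [he]) (VV_zpow 1 (e0 - e)))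
    by_cases h1 : j = m
    · subst h1
      rw [hbm]
      exact VV_mono (by simp [he]) (VV_zpow 1 (e1 - e))
    · simp only [b, if_neg h0, if_neg h1]; exact zero_mem _
  have hu : ∃ j ≤ m, b j ≠ 0 ∧ (1 : ℕ) * ord (b j) = j * 0 := by
    rcases min_choice e0 e1 with h | h
    · refine ⟨0, Nat.zero_le _, ?_, ?_⟩
      · rw [hb0]; exact neg_ne_zero.2 (hpz _)
      · rw [hb0, ord_neg, ord_zpow]; simp; omega
    · refine ⟨m, le_rfl, ?_, ?_⟩
      · rw [hbm]; exact hpz _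
      · rw [hbm, ord_zpow]; simp; omega
  obtain ⟨f, hf1, _, hf3⟩ := TT_surj (r := 1) one_pos hb hu (ord c - e)
    (fun t => (p : LL) ^ (t - e) * c)
    (fun t => by
      dsimp only
      rw [show t + ((1 : ℕ) : ℤ) - e = 1 + (t - e) by push_cast; ring, zpow_add₀ pne, zpow_one]
      ring)
    (fun t => by
      by_cases hc : c = 0
      · simp only [hc, mul_zero]; exact zero_mem _
      · right
        rw [ord_mul (hpz _) hc, ord_zpow]
        simp; linarith)
  refine ⟨f 0, ?_⟩
  have h := hf3 0
  rw [TT, ← Finset.sum_subset (s₁ := {0, m}) (by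
    intro x hx
    simp only [Finset.mem_insert, Finset.mem_singleton] at hx
    rw [Finset.mem_range]; omega) (by
    intro x _ hx
    simp only [Finset.mem_insert, Finset.mem_singleton, not_or] at hx
    simp [b, hx.1, hx.2]), Finset.sum_pair hm.ne, hb0, hbm] at h
  simp only [mul_zero, sub_zero, Function.iterate_zero, id_eq, zero_sub] at h
  rw [zpow_sub₀ pne, zpow_sub₀ pne, zpow_neg] at h
  have := hpz e
  field_simp at h
  rw [← h]; ring

end keysec


section simplesec

variable {p : ℕ} [Fact p.Prime] {k : Type*} [Field k] [IsAlgClosed k] [CharP k p]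

/-- The fraction field. -/
local notation "LL" => FractionRing (WittVector p k)

/-- Index permutation. -/
theorem slope_index (r : ℕ) (s : ℤ) : ∃ (φ : Fin r → Fin r) (e : Fin r → ℤ),
    Function.Bijective φ ∧ (∀ j, ((φ j : ℕ) : ℤ) + s = r * e j + (j : ℕ)) ∧
    ∀ (a : Fin r → LL) (j : Fin r),
      slopeFrob p k r s a j = (p : LL) ^ (e j) * fracWittFrobenius p k (a (φ j)) := by
  have h1 : ∀ j : Fin r, 0 ≤ (((j : ℕ) : ℤ) - s) % r := fun j =>
    Int.emod_nonneg _ (Int.natCast_ne_zero.mpr j.pos.ne')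
  have h2 : ∀ j : Fin r, (((j : ℕ) : ℤ) - s) % r < r := fun j =>
    Int.emod_lt_of_pos _ (by exact_mod_cast j.pos)
  let φ : Fin r → Fin r := fun j => ⟨((((j : ℕ) : ℤ) - s) % r).toNat, by
    have := h1 j; have := h2 j; omega⟩
  have hφ : ∀ j, ((φ j : ℕ) : ℤ) = (((j : ℕ) : ℤ) - s) % r := fun j => by
    simp only [φ]; exact Int.toNat_of_nonneg (h1 j)
  let e : Fin r → ℤ := fun j => ((((j : ℕ) : ℤ) - s) % r + s) / r
  have he : ∀ j, ((φ j : ℕ) : ℤ) + s = r * e j + (j : ℕ) := by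
    intro j
    rw [hφ]
    have hr : (0 : ℤ) < r := by exact_mod_cast j.pos
    have h3 := Int.emod_add_mul_ediv (((j : ℕ) : ℤ) - s) r
    have h4 : (((j : ℕ) : ℤ) - s) % r + s = (j : ℕ) + r * (-((((j : ℕ) : ℤ) - s) / r)) := by
      linarith [mul_neg (r : ℤ) ((((j : ℕ) : ℤ) - s) / r)]
    have h5 : e j = -((((j : ℕ) : ℤ) - s) / r) := by
      simp only [e]
      rw [h4, Int.add_mul_ediv_left _ _ hr.ne', Int.ediv_eq_zero_of_lt (by positivity)
        (by exact_mod_cast j.2), zero_add]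
    rw [h5, h4]; ring
  refine ⟨φ, e, Finite.injective_iff_bijective.1 ?_, he, fun a j => rfl⟩
  intro i j hij
  have hi := he i
  have hj := he j
  rw [hij, hj] at hi
  have : ((i : ℕ) : ℤ) - (j : ℕ) = r * (e j - e i) := by linarith [mul_sub (r : ℤ) (e j) (e i)]
  have hd : (r : ℤ) ∣ ((i : ℕ) : ℤ) - (j : ℕ) := ⟨_, this⟩
  have h0 := Int.eq_zero_of_abs_lt_dvd hd (by
    have := i.2; have := j.2
    rw [abs_lt]; constructor <;> omega)
  ext; omega

theorem VV_sigma_iff {r : ℕ} {t : ℤ} {x : LL} :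
    fracWittFrobenius p k x ∈ VV p k r t ↔ x ∈ VV p k r t := by
  refine ⟨fun h => ?_, VV_sigma⟩
  by_cases hx : x = 0
  · exact Or.inl hx
  · right
    rw [← ord_sigma hx]
    exact h.resolve_left (by simpa using hx)

/-- Filtration on `L^r`. -/
def Wt (r : ℕ) (m : ℤ) (a : Fin r → LL) : Prop := ∀ j : Fin r, a j ∈ VV p k r (m - (j : ℕ))

/-- `m` is the exact level of `a`. -/
def Lead (r : ℕ) (m : ℤ) (a : Fin r → LL) : Prop := Wt r m a ∧ ¬ Wt r (m + 1) a

theorem Wt_mono {r : ℕ} {m n : ℤ} (h : n ≤ m) {a : Fin r → LL} (ha : Wt r m a) : Wt r n a :=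
  fun j => VV_mono (by linarith) (ha j)

theorem Lead_unique {r : ℕ} {m n : ℤ} {a : Fin r → LL} (h : Lead r m a) (h' : Lead r n a) :
    m = n := by
  rcases lt_trichotomy m n with hl | hl | hl
  · exact absurd (Wt_mono hl h'.1) h.2
  · exact hl
  · exact absurd (Wt_mono hl h.1) h'.2

theorem exists_lead {r : ℕ} {a : Fin r → LL} (ha : a ≠ 0) : ∃ m, Lead r m a := by
  classical
  have hne : (univ.filter fun j => a j ≠ 0).Nonempty := by
    by_contra h
    rw [Finset.not_nonempty_iff_eq_empty, Finset.filter_eq_empty_iff] at h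
    apply ha
    ext j
    simpa using h (Finset.mem_univ j)
  obtain ⟨j0, hj0, hmin⟩ := Finset.exists_min_image _ (fun j : Fin r => r * ord (a j) + (j : ℕ)) hne
  simp only [Finset.mem_filter, Finset.mem_univ, true_and] at hj0 hmin
  refine ⟨r * ord (a j0) + (j0 : ℕ), fun j => ?_, fun h => ?_⟩
  · by_cases h : a j = 0
    · exact Or.inl h
    · right; linarith [hmin j h]
  · have := (h j0).resolve_left hj0
    linarith

theorem Wt_smul {r : ℕ} {m : ℤ} {a : Fin r → LL} {c : LL} (hc : c ≠ 0) (h : Wt r m a) :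
    Wt r (m + r * ord c) (c • a) := fun j => by
  have := VV_mul (p := p) (k := k) (r := r) (x := c) (Or.inr le_rfl) (h j)
  exact VV_mono (by linarith) this

theorem ord_inv {c : LL} (hc : c ≠ 0) : ord c⁻¹ = - ord c := by
  have h := ord_mul hc (inv_ne_zero hc)
  have h1 := ord_zpow (p := p) (k := k) 0
  rw [mul_inv_cancel₀ hc] at h
  rw [zpow_zero] at h1
  omega

theorem Lead_smul {r : ℕ} {m : ℤ} {a : Fin r → LL} {c : LL} (hc : c ≠ 0) (h : Lead r m a) :
    Lead r (m + r * ord c) (c • a) := by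
  refine ⟨Wt_smul hc h.1, fun h' => h.2 ?_⟩
  have h2 := Wt_smul (inv_ne_zero hc) h'
  rw [inv_smul_smul₀ hc, ord_inv hc] at h2
  exact Wt_mono (by linarith [mul_neg (r : ℤ) (ord c)]) h2

theorem Wt_slope {r : ℕ} {s m : ℤ} {a : Fin r → LL} :
    Wt r (m + s) (slopeFrob p k r s a) ↔ Wt r m a := by
  obtain ⟨φ, e, hbij, he, hF⟩ := slope_index (p := p) (k := k) r s
  constructor
  · intro h i
    obtain ⟨j, rfl⟩ := hbij.2 i
    have h1 := VV_mul (VV_zpow (p := p) (k := k) r (-(e j))) (h j)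
    rw [hF, ← mul_assoc, ← zpow_add₀ pne, neg_add_cancel, zpow_zero, one_mul, VV_sigma_iff] at h1
    exact VV_mono (by linarith [he j, mul_neg (r : ℤ) (e j)]) h1
  · intro h j
    rw [hF]
    exact VV_mono (by linarith [he j]) (VV_mul (VV_zpow r (e j)) (VV_sigma (h (φ j))))

theorem Lead_slope {r : ℕ} {s m : ℤ} {a : Fin r → LL} (h : Lead r m a) :
    Lead r (m + s) (slopeFrob p k r s a) := by
  refine ⟨Wt_slope.2 h.1, fun h' => h.2 ?_⟩
  rw [add_right_comm, Wt_slope] at h'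
  exact h'

theorem Lead_slope_iter {r : ℕ} {s m : ℤ} {a : Fin r → LL} (h : Lead r m a) (i : ℕ) :
    Lead r (m + i * s) ((slopeFrob p k r s)^[i] a) := by
  induction i with
  | zero => simpa using h
  | succ i ih =>
    rw [Function.iterate_succ_apply']
    have := Lead_slope (s := s) ih
    convert this using 1
    push_cast; ring

theorem Wt_sum {r : ℕ} {m : ℤ} {ι : Type*} (S : Finset ι) (f : ι → Fin r → LL)
    (h : ∀ i ∈ S, Wt r m (f i)) : Wt r m (∑ i ∈ S, f i) := fun j => by
  rw [Finset.sum_apply]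
  exact sum_mem fun i hi => h i hi j

theorem slope_li {r : ℕ} {s : ℤ} (hrs : Nat.Coprime s.natAbs r) {a : Fin r → LL} (ha : a ≠ 0) :
    LinearIndependent LL (fun i : Fin r => (slopeFrob p k r s)^[i] a) := by
  classical
  obtain ⟨m, hm⟩ := exists_lead ha
  rw [Fintype.linearIndependent_iff]
  intro g hg
  by_contra hne
  push Not at hne
  obtain ⟨i1, hi1⟩ := hne
  obtain ⟨i0, hi0, hmin⟩ := Finset.exists_min_image (univ.filter fun i => g i ≠ 0)
    (fun i : Fin r => m + (i : ℕ) * s + r * ord (g i)) ⟨i1, by simpa using hi1⟩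
  simp only [Finset.mem_filter, Finset.mem_univ, true_and] at hi0 hmin
  have hL : ∀ i, g i ≠ 0 → Lead r (m + (i : ℕ) * s + r * ord (g i))
      (g i • (slopeFrob p k r s)^[i] a) := fun i hi => Lead_smul hi (Lead_slope_iter hm i)
  rw [← Finset.add_sum_erase _ _ (Finset.mem_univ i0)] at hg
  apply (hL i0 hi0).2
  rw [eq_neg_of_add_eq_zero_left hg]
  have : Wt r (m + (i0 : ℕ) * s + r * ord (g i0) + 1)
      (∑ x ∈ univ.erase i0, g x • (slopeFrob p k r s)^[x] a) := by
    refine Wt_sum _ _ fun i hi => ?_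
    have hii : i ≠ i0 := (Finset.mem_erase.1 hi).1
    by_cases h : g i = 0
    · rw [h, zero_smul]; exact fun j => zero_mem _
    refine Wt_mono ?_ (hL i h).1
    refine lt_of_le_of_ne (hmin i h) fun heq => hii ?_
    have hd : (r : ℤ) ∣ s * (((i : ℕ) : ℤ) - (i0 : ℕ)) := by
      refine ⟨ord (g i0) - ord (g i), ?_⟩
      linear_combination -heq
    have hco : IsCoprime (r : ℤ) s := by
      rw [Int.isCoprime_iff_gcd_eq_one]
      simpa [Int.gcd, Nat.Coprime, Nat.gcd_comm] using hrs
    have hd2 := hco.dvd_of_dvd_mul_left hd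
    have h0 := Int.eq_zero_of_abs_lt_dvd hd2 (by
      have := i.2; have := i0.2
      rw [abs_lt]; constructor <;> omega)
    ext; omega
  intro j
  exact neg_mem (this j)

theorem simple_part (lam : ℚ) (U : Submodule LL (Fin lam.den → LL))
    (hU : ∀ x ∈ U, Nlam p k lam x ∈ U) : U = ⊥ ∨ U = ⊤ := by
  by_cases h : U = ⊥
  · exact Or.inl h
  right
  obtain ⟨a, haU, ha⟩ := U.ne_bot_iff.1 h
  have hli := slope_li (p := p) (k := k) lam.reduced ha
  have hs := hli.span_eq_top_of_card_eq_finrank' (by simp)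
  rw [eq_top_iff, ← hs, Submodule.span_le]
  rintro _ ⟨i, rfl⟩
  have : ∀ i : ℕ, (slopeFrob p k lam.den lam.num)^[i] a ∈ U := by
    intro i
    induction i with
    | zero => exact haU
    | succ i ih => rw [Function.iterate_succ_apply']; exact hU _ ih
  exact this i

theorem eigen_slope {lam mu : ℚ} {a : Fin mu.den → LL} (ha : a ≠ 0)
    (h : (Nlam p k mu)^[lam.den] a = (p : LL) ^ lam.num • a) : mu = lam := by
  obtain ⟨m, hm⟩ := exists_lead ha
  have h1 := Lead_slope_iter (s := mu.num) hm lam.den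
  have h2 := Lead_smul (zpow_ne_zero lam.num (pne (p := p) (k := k))) hm
  rw [← h] at h2
  have h3 := Lead_unique h1 h2
  rw [ord_zpow] at h3
  rw [Rat.eq_iff_mul_eq_mul]
  linarith

/-- Extended standard basis. -/
noncomputable def EE (r : ℕ) (t : ℤ) (j : Fin r) : LL :=
  if (r : ℤ) ∣ t - (j : ℕ) then (p : LL) ^ ((t - (j : ℕ)) / r) else 0

theorem EE_slope (r : ℕ) (s t : ℤ) :
    slopeFrob p k r s (EE r t) = EE r (t + s) := by
  obtain ⟨φ, e, hbij, he, hF⟩ := slope_index (p := p) (k := k) r s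
  ext j
  rw [hF]
  have hr : (r : ℤ) ≠ 0 := by exact_mod_cast j.pos.ne'
  have h1 : t + s - (j : ℕ) = t - (φ j : ℕ) + r * e j := by linarith [he j]
  rw [EE, EE, h1]
  by_cases h : (r : ℤ) ∣ t - (φ j : ℕ)
  · rw [if_pos h, if_pos (dvd_add h (dvd_mul_right _ _)), sigma_zpow,
      Int.add_mul_ediv_left _ _ hr, zpow_add₀ pne, mul_comm]
  · rw [if_neg h, if_neg (fun h' => h ((Int.dvd_add_left (dvd_mul_right _ _)).1 h'))]
    simp

theorem EE_add (r : ℕ) (t m : ℤ) : EE (p := p) (k := k) r (t + r * m) = (p : LL) ^ m • EE r t := by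
  ext j
  have hr : (r : ℤ) ≠ 0 := by exact_mod_cast j.pos.ne'
  have h1 : t + r * m - (j : ℕ) = t - (j : ℕ) + r * m := by ring
  rw [Pi.smul_apply, EE, EE, h1]
  by_cases h : (r : ℤ) ∣ t - (j : ℕ)
  · rw [if_pos h, if_pos (dvd_add h (dvd_mul_right _ _)),
      Int.add_mul_ediv_left _ _ hr, zpow_add₀ pne, mul_comm, smul_eq_mul]
  · rw [if_neg h, if_neg (fun h' => h ((Int.dvd_add_left (dvd_mul_right _ _)).1 h'))]
    simp

theorem EE_single {r : ℕ} (i : Fin r) : EE (p := p) (k := k) r (i : ℕ) = Pi.single i 1 := by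
  ext j
  rw [EE]
  by_cases h : j = i
  · subst h; simp
  · rw [Pi.single_eq_of_ne h, if_neg]
    intro hd
    have h0 := Int.eq_zero_of_abs_lt_dvd hd (by
      have := i.2; have := j.2
      rw [abs_lt]; constructor <;> omega)
    exact h (by ext; omega)

theorem EE_eigen (lam : ℚ) (i : Fin lam.den) :
    (Nlam p k lam)^[lam.den] (Pi.single i 1) = (p : LL) ^ lam.num • Pi.single i 1 := by
  rw [← EE_single, ← EE_add]
  have : ∀ n : ℕ, (Nlam p k lam)^[n] (EE lam.den (i : ℕ)) = EE lam.den ((i : ℕ) + n * lam.num) := by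
    intro n
    induction n with
    | zero => simp
    | succ n ih =>
      rw [Function.iterate_succ_apply', ih]
      refine (EE_slope _ _ _).trans ?_
      congr 1; push_cast; ring
  rw [this]

end simplesec


/-- Semilinear maps. -/
structure SL (p : ℕ) [Fact p.Prime] (k : Type*) [Field k] [IsAlgClosed k] [CharP k p]
    {N : Type*} [AddCommGroup N] [Module (FractionRing (WittVector p k)) N] (F : N → N) : Prop where
  add : ∀ x y, F (x + y) = F x + F y
  smul : ∀ (c : FractionRing (WittVector p k)) (x : N), F (c • x) = fracWittFrobenius p k c • F x

section exsec

variable {p : ℕ} [Fact p.Prime] {k : Type*} [Field k] [IsAlgClosed k] [CharP k p]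

/-- The fraction field. -/
local notation "LL" => FractionRing (WittVector p k)

variable {N : Type*} [AddCommGroup N] [Module (FractionRing (WittVector p k)) N] {F : N → N}

theorem SL.zero (h : SL p k F) : F 0 = 0 := by
  have := h.smul 0 0
  simpa using this

theorem SL.neg (h : SL p k F) (x : N) : F (-x) = -F x := by
  have := h.smul (-1) x
  simpa using this

theorem SL.sub (h : SL p k F) (x y : N) : F (x - y) = F x - F y := by
  rw [sub_eq_add_neg, h.add, h.neg, sub_eq_add_neg]

theorem SL.sum (h : SL p k F) {ι : Type*} (S : Finset ι) (f : ι → N) :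
    F (∑ i ∈ S, f i) = ∑ i ∈ S, F (f i) := by
  classical
  induction S using Finset.induction_on with
  | empty => simpa using h.zero
  | insert i S hi ih => rw [Finset.sum_insert hi, Finset.sum_insert hi, h.add, ih]

theorem SL.zpow (h : SL p k F) (m : ℤ) (x : N) : F ((p : LL) ^ m • x) = (p : LL) ^ m • F x := by
  rw [h.smul, sigma_zpow]

theorem SL.iter_zpow (h : SL p k F) (m : ℤ) (x : N) (i : ℕ) :
    F^[i] ((p : LL) ^ m • x) = (p : LL) ^ m • F^[i] x := by
  induction i with
  | zero => rfl
  | succ i ih => rw [Function.iterate_succ_apply', ih, h.zpow, Function.iterate_succ_apply']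

theorem SL.iter_smul (h : SL p k F) (c : LL) (x : N) (i : ℕ) :
    F^[i] (c • x) = (fracWittFrobenius p k)^[i] c • F^[i] x := by
  induction i with
  | zero => rfl
  | succ i ih => rw [Function.iterate_succ_apply', ih, h.smul, Function.iterate_succ_apply',
      Function.iterate_succ_apply']

theorem SL.iter_add (h : SL p k F) (x y : N) (i : ℕ) :
    F^[i] (x + y) = F^[i] x + F^[i] y := by
  induction i with
  | zero => rfl
  | succ i ih => rw [Function.iterate_succ_apply', ih, h.add, Function.iterate_succ_apply',
      Function.iterate_succ_apply']

theorem SL.iter_sub (h : SL p k F) (x y : N) (i : ℕ) :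
    F^[i] (x - y) = F^[i] x - F^[i] y := by
  induction i with
  | zero => rfl
  | succ i ih => rw [Function.iterate_succ_apply', ih, h.sub, Function.iterate_succ_apply',
      Function.iterate_succ_apply']

/-- Partial sums. -/
noncomputable def CC (s : ℤ) (a : ℕ → LL) (c : ℤ → LL) (i : ℕ) (t : ℤ) : LL :=
  ∑ l ∈ range i, (fracWittFrobenius p k)^[l] (a (i - 1 - l)) *
    (fracWittFrobenius p k)^[l + 1] (c (t - (l + 1 : ℕ) * s))

theorem CC_succ (s : ℤ) (a : ℕ → LL) (c : ℤ → LL) (i : ℕ) (t : ℤ) :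
    CC s a c (i + 1) t = fracWittFrobenius p k (CC s a c i (t - s)) +
      fracWittFrobenius p k (c (t - s)) * a i := by
  rw [CC, Finset.sum_range_succ', CC, map_sum]
  congr 1
  · refine Finset.sum_congr rfl fun l hl => ?_
    have hl' := Finset.mem_range.1 hl
    rw [map_mul, ← Function.iterate_succ_apply' (f := fracWittFrobenius p k),
      ← Function.iterate_succ_apply' (f := fracWittFrobenius p k)]
    have e1 : i + 1 - 1 - (l + 1) = i - 1 - l := by omega
    have e2 : t - ((l + 1 + 1 : ℕ) : ℤ) * s = t - s - ((l + 1 : ℕ) : ℤ) * s := by push_cast; ring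
    rw [e1, e2]
  · simp [mul_comm]

theorem CC_QQ {r : ℕ} {s : ℤ} {a : ℕ → LL} {c : ℤ → LL} (hc : QQ r c) (i : ℕ) :
    QQ r (CC s a c i) := by
  intro t
  rw [CC, CC, Finset.mul_sum]
  refine Finset.sum_congr rfl fun l _ => ?_
  rw [show t + r - ((l + 1 : ℕ) : ℤ) * s = t - ((l + 1 : ℕ) : ℤ) * s + r by ring, hc,
    sigma_iter_p_mul]
  ring

theorem ord_sigma_iter (j : ℕ) {x : LL} (hx : x ≠ 0) :
    (fracWittFrobenius p k)^[j] x ≠ 0 ∧ ord ((fracWittFrobenius p k)^[j] x) = ord x := by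
  induction j with
  | zero => exact ⟨hx, rfl⟩
  | succ j ih =>
    rw [Function.iterate_succ_apply', ord_sigma ih.1]
    exact ⟨by simpa using ih.1, ih.2⟩

theorem iter_li {x : N} (n : ℕ)
    (hmin : ∀ m < n, F^[m] x ∉ Submodule.span LL (Set.range fun i : Fin m => F^[(i : ℕ)] x)) :
    LinearIndependent LL (fun i : Fin n => F^[(i : ℕ)] x) := by
  induction n with
  | zero => exact linearIndependent_empty_type
  | succ n ih =>
    rw [linearIndependent_finSucc']
    exact ⟨ih fun m hm => hmin m (by omega), hmin n (by omega)⟩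

theorem exists_min_rel [FiniteDimensional LL N] (x : N) (hx : x ≠ 0) : ∃ (n : ℕ) (a : ℕ → LL), 0 < n ∧
    LinearIndependent LL (fun i : Fin n => F^[(i : ℕ)] x) ∧
    F^[n] x = ∑ i ∈ range n, a i • F^[i] x := by
  classical
  have hex : ∃ n, F^[n] x ∈ Submodule.span LL (Set.range fun i : Fin n => F^[(i : ℕ)] x) := by
    by_contra! h
    have := (iter_li (F := F) (x := x) (Module.finrank LL N + 1) fun m _ => h m).fintype_card_le_finrank
    simp at this
  obtain ⟨a, ha⟩ := Submodule.mem_span_range_iff_exists_fun LL |>.1 (Nat.find_spec hex)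
  refine ⟨Nat.find hex, fun i => if h : i < Nat.find hex then a ⟨i, h⟩ else 0, ?_,
    iter_li _ fun m hm => Nat.find_min hex hm, ?_⟩
  · rw [Nat.pos_iff_ne_zero]
    intro h0
    rw [Nat.find_eq_zero] at h0
    simp at h0
    exact hx h0
  · rw [Finset.sum_range, ← ha]
    refine Finset.sum_congr rfl fun i _ => ?_
    beta_reduce
    rw [dif_pos i.2]

theorem exists_eigen [FiniteDimensional LL N] [Nontrivial N] (hF : SL p k F)
    (hinj : Function.Injective F) :
    ∃ (lam : ℚ) (x : N), x ≠ 0 ∧ F^[lam.den] x = (p : LL) ^ lam.num • x := by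
  classical
  obtain ⟨x, hx⟩ := exists_ne (0 : N)
  obtain ⟨n, a, hn, hli, hrel⟩ := exists_min_rel (p := p) (k := k) (F := F) x hx
  have hne : ((range n).filter fun i => a i ≠ 0).Nonempty := by
    by_contra h
    rw [Finset.not_nonempty_iff_eq_empty, Finset.filter_eq_empty_iff] at h
    have h0 : F^[n] x = 0 := by
      rw [hrel]
      refine Finset.sum_eq_zero fun i hi => ?_
      have := h hi
      rw [not_not] at this
      rw [this, zero_smul]
    have hz : ∀ m, F^[m] (0 : N) = 0 := fun m => by
      induction m with
      | zero => rfl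
      | succ m ih => rw [Function.iterate_succ_apply', ih, hF.zero]
    exact hx (hinj.iterate n (h0.trans (hz n).symm))
  obtain ⟨i0, hi0, hmin⟩ := Finset.exists_min_image _
    (fun i : ℕ => (ord (a i) : ℚ) / ((n : ℚ) - i)) hne
  simp only [Finset.mem_filter, Finset.mem_range] at hi0 hmin
  set lam : ℚ := (ord (a i0) : ℚ) / ((n : ℚ) - i0) with hlam
  have hden : (0 : ℚ) < lam.den := by exact_mod_cast lam.pos
  have hnd : lam = (lam.num : ℚ) / lam.den := (Rat.num_div_den lam).symm
  have hpos : ∀ i < n, (0 : ℚ) < (n : ℚ) - i := fun i hi => by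
    rw [sub_pos]; exact_mod_cast hi
  have hle : ∀ i < n, a i ≠ 0 → ((n : ℤ) - i) * lam.num ≤ lam.den * ord (a i) := by
    intro i hi hai
    have h1 := hmin i ⟨hi, hai⟩
    rw [hnd, div_le_div_iff₀ hden (hpos i hi)] at h1
    have : (((n : ℤ) - i) * lam.num : ℚ) ≤ lam.den * ord (a i) := by push_cast; linarith
    exact_mod_cast this
  have heq : (lam.den : ℤ) * ord (a i0) = ((n : ℤ) - i0) * lam.num := by
    have h1 : (ord (a i0) : ℚ) / ((n : ℚ) - i0) = (lam.num : ℚ) / lam.den := by rw [← hnd]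
    rw [div_eq_div_iff (hpos i0 hi0.1).ne' hden.ne'] at h1
    have : (lam.den * ord (a i0) : ℚ) = ((n : ℤ) - i0) * lam.num := by push_cast; linarith
    exact_mod_cast this
  clear_value lam
  let b : ℕ → LL := fun j => match j with
    | 0 => 1
    | j + 1 => -(fracWittFrobenius p k)^[j] (a (n - 1 - j))
  have hone : ord (1 : LL) = 0 := by
    have := ord_zpow (p := p) (k := k) 0
    rwa [zpow_zero] at this
  obtain ⟨c, hcQ, hc0, hcT⟩ := TT_ker (p := p) (k := k) (r := lam.den) (n := n) (s := lam.num)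
    (b := b) lam.pos (by
      intro j hj
      cases j with
      | zero => right; simp [b, hone]
      | succ j =>
        by_cases h : a (n - 1 - j) = 0
        · left; simp [b, h]
        · right
          have h1 := ord_sigma_iter j h
          simp only [b]
          rw [ord_neg, h1.2]
          have h2 := hle (n - 1 - j) (by omega) h
          rwa [show (n : ℤ) - ((n - 1 - j : ℕ) : ℤ) = ((j + 1 : ℕ) : ℤ) by omega] at h2)
    one_ne_zero hone (by
      have h0 : n - 1 - (n - 1 - i0) = i0 := by omega
      have h1 := ord_sigma_iter (n - 1 - i0) hi0.2
      refine ⟨(n - 1 - i0) + 1, by omega, by omega, ?_, ?_⟩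
      · simp only [b]; rw [h0]; exact neg_ne_zero.2 h1.1
      · simp only [b]; rw [h0, ord_neg, h1.2, heq]
        congr 1; omega)
  have hCn : ∀ t, CC lam.num a c n t = c t := by
    intro t
    have h := hcT t
    rw [TT, Finset.sum_range_succ'] at h
    simp only [b, neg_mul, Finset.sum_neg_distrib] at h
    simp only [Function.iterate_zero, id, Nat.cast_zero, zero_mul, sub_zero, one_mul] at h
    rw [CC]
    exact (neg_add_eq_zero.1 h)
  let y : ℤ → N := fun t => ∑ i ∈ range n, CC lam.num a c (i + 1) t • F^[i] x
  have hyF : ∀ t, F (y t) = y (t + lam.num) := by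
    intro t
    simp only [y]
    rw [hF.sum]
    obtain ⟨m, rfl⟩ : ∃ m, n = m + 1 := ⟨n - 1, by omega⟩
    have e1 : ∀ i, F (CC lam.num a c (i + 1) t • F^[i] x) =
        fracWittFrobenius p k (CC lam.num a c (i + 1) t) • F^[i + 1] x := fun i => by
      rw [hF.smul, Function.iterate_succ_apply']
    simp only [e1]
    rw [Finset.sum_range_succ, hCn, hrel, Finset.smul_sum]
    have e2 : ∑ i ∈ range m, fracWittFrobenius p k (CC lam.num a c (i + 1) t) • F^[i + 1] x =
        ∑ i ∈ range (m + 1), fracWittFrobenius p k (CC lam.num a c i t) • F^[i] x := by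
      rw [Finset.sum_range_succ']
      simp [CC]
    rw [e2, ← Finset.sum_add_distrib]
    refine Finset.sum_congr rfl fun i _ => ?_
    rw [CC_succ, add_sub_cancel_right, add_smul, smul_smul]
  have hyQ : ∀ t (m : ℤ), y (t + lam.den * m) = (p : LL) ^ m • y t := by
    intro t m
    simp only [y]
    rw [Finset.smul_sum]
    refine Finset.sum_congr rfl fun i _ => ?_
    rw [QQ_mul (CC_QQ hcQ (i + 1)), smul_smul]
  refine ⟨lam, y 0, fun h => ?_, ?_⟩
  · rw [Fintype.linearIndependent_iff] at hli
    simp only [y] at h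
    rw [Finset.sum_range] at h
    have := hli _ h ⟨n - 1, by omega⟩
    simp only [Nat.sub_add_cancel hn] at this
    rw [hCn] at this
    exact hc0 this
  · rw [← hyQ]
    have : ∀ m : ℕ, F^[m] (y 0) = y (0 + m * lam.num) := by
      intro m
      induction m with
      | zero => simp
      | succ m ih =>
        rw [Function.iterate_succ_apply', ih, hyF]
        congr 1; push_cast; ring
    rw [this]

end exsec

section ex2sec

variable {p : ℕ} [Fact p.Prime] {k : Type*} [Field k] [IsAlgClosed k] [CharP k p]

/-- The fraction field. -/
local notation "LL" => FractionRing (WittVector p k)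

variable {N : Type*} [AddCommGroup N] [Module (FractionRing (WittVector p k)) N] {F : N → N}

/-- Eigenvectors of slope `lam`. -/
def Eig (p : ℕ) [Fact p.Prime] (k : Type*) [Field k] [IsAlgClosed k] [CharP k p] {N : Type*}
    [AddCommGroup N] [Module (FractionRing (WittVector p k)) N] (F : N → N) (lam : ℚ) (x : N) :
    Prop :=
  F^[lam.den] x = (p : FractionRing (WittVector p k)) ^ lam.num • x

/-- The span of all eigenvectors. -/
noncomputable def SS (p : ℕ) [Fact p.Prime] (k : Type*) [Field k] [IsAlgClosed k] [CharP k p] {N : Type*}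
    [AddCommGroup N] [Module (FractionRing (WittVector p k)) N] (F : N → N) :
    Submodule (FractionRing (WittVector p k)) N :=
  Submodule.span (FractionRing (WittVector p k)) {x | ∃ lam, Eig p k F lam x}

theorem Eig.mapF (hF : SL p k F) {lam : ℚ} {x : N} (hx : Eig p k F lam x) : Eig p k F lam (F x) := by
  rw [Eig, ← Function.iterate_succ_apply, Function.iterate_succ_apply', hx, hF.zpow]

theorem Eig.iter {lam : ℚ} {x : N} (hF : SL p k F) (hx : Eig p k F lam x) (m : ℕ) :
    F^[lam.den * m] x = (p : LL) ^ (lam.num * m) • x := by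
  induction m with
  | zero => simp
  | succ m ih =>
    rw [Nat.mul_succ, Function.iterate_add_apply, hx, hF.iter_zpow, ih, smul_smul, ← zpow_add₀ pne]
    congr 2; push_cast; ring

theorem SS_F (hF : SL p k F) {x : N} (hx : x ∈ SS p k F) : F x ∈ SS p k F := by
  rw [SS] at hx
  induction hx using Submodule.span_induction with
  | mem x hx =>
    obtain ⟨lam, h⟩ := hx
    exact Submodule.subset_span ⟨lam, h.mapF hF⟩
  | zero => rw [hF.zero]; exact zero_mem _
  | add x y _ _ h1 h2 => rw [hF.add]; exact add_mem h1 h2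
  | smul c x _ h => rw [hF.smul]; exact Submodule.smul_mem _ _ h

theorem SS_F_iter (hF : SL p k F) {x : N} (hx : x ∈ SS p k F) (n : ℕ) : F^[n] x ∈ SS p k F := by
  induction n with
  | zero => exact hx
  | succ n ih => rw [Function.iterate_succ_apply']; exact SS_F hF ih

theorem SS_surj (hF : SL p k F) (hb : Function.Bijective F) {x : N} (hx : x ∈ SS p k F) :
    ∃ y ∈ SS p k F, F y = x := by
  rw [SS] at hx
  induction hx using Submodule.span_induction with
  | mem x hx =>
    obtain ⟨lam, h⟩ := hx
    obtain ⟨y, rfl⟩ := hb.2 x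
    refine ⟨y, Submodule.subset_span ⟨lam, ?_⟩, rfl⟩
    apply hb.1
    rw [hF.zpow, ← h, ← Function.iterate_succ_apply, Function.iterate_succ_apply']
  | zero => exact ⟨0, zero_mem _, hF.zero⟩
  | add x y _ _ h1 h2 =>
    obtain ⟨a, ha, rfl⟩ := h1
    obtain ⟨b, hb, rfl⟩ := h2
    exact ⟨a + b, add_mem ha hb, hF.add _ _⟩
  | smul c x _ h =>
    obtain ⟨a, ha, rfl⟩ := h
    obtain ⟨d, rfl⟩ := (fracWittFrobenius p k).surjective c
    exact ⟨d • a, Submodule.smul_mem _ _ ha, hF.smul _ _⟩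

theorem SS_F_inv (hF : SL p k F) (hb : Function.Bijective F) {x : N} (hx : F x ∈ SS p k F) :
    x ∈ SS p k F := by
  obtain ⟨y, hy, h⟩ := SS_surj hF hb hx
  rwa [← hb.1 h]

theorem SS_op_surj (hF : SL p k F) {lam : ℚ} {u : N} (hu : u ∈ SS p k F) :
    ∃ z ∈ SS p k F, F^[lam.den] z - (p : LL) ^ lam.num • z = u := by
  rw [SS] at hu
  induction hu using Submodule.closure_induction with
  | zero => exact ⟨0, zero_mem _, by
      have h0 := hF.iter_zpow 0 (0 : N) lam.den
      have h1 := hF.iter_sub (0 : N) 0 lam.den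
      simp only [sub_self] at h1
      rw [h1]; simp⟩
  | add x y _ _ h1 h2 =>
    obtain ⟨a, ha, rfl⟩ := h1
    obtain ⟨b, hb, rfl⟩ := h2
    exact ⟨a + b, add_mem ha hb, by rw [hF.iter_add, smul_add]; abel⟩
  | smul_mem c x hx =>
    obtain ⟨mu, hx⟩ := hx
    obtain ⟨d, hd⟩ := sigma_surj (p := p) (k := k) (mu.den * lam.den)
      (Nat.mul_pos mu.pos lam.pos) (lam.num * mu.den) (mu.num * lam.den) c
    have hxS : x ∈ SS p k F := Submodule.subset_span ⟨mu, hx⟩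
    let g : ℕ → N := fun i => (p : LL) ^ (lam.num * ((mu.den : ℤ) - i)) • F^[lam.den * i] (d • x)
    refine ⟨∑ i ∈ range mu.den, (p : LL) ^ (lam.num * ((mu.den : ℤ) - 1 - i)) •
      F^[lam.den * i] (d • x), sum_mem fun i _ => Submodule.smul_mem _ _
        (SS_F_iter hF (Submodule.smul_mem _ _ hxS) _), ?_⟩
    have hsum : ∀ (S : Finset ℕ) (f : ℕ → N) (n : ℕ),
        F^[n] (∑ i ∈ S, f i) = ∑ i ∈ S, F^[n] (f i) := by
      intro S f n
      induction n with
      | zero => rfl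
      | succ n ih => simp only [Function.iterate_succ_apply', ih, hF.sum]
    rw [hsum, Finset.smul_sum, ← Finset.sum_sub_distrib]
    have : ∀ i ∈ range mu.den, F^[lam.den] ((p : LL) ^ (lam.num * ((mu.den : ℤ) - 1 - i)) •
        F^[lam.den * i] (d • x)) - (p : LL) ^ lam.num •
        ((p : LL) ^ (lam.num * ((mu.den : ℤ) - 1 - i)) • F^[lam.den * i] (d • x)) =
        g (i + 1) - g i := by
      intro i _
      rw [hF.iter_zpow, ← Function.iterate_add_apply, smul_smul, ← zpow_add₀ pne]
      simp only [g]
      congr 2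
      · congr 1; push_cast; ring
      · congr 1; ring
      · congr 1; ring
    rw [Finset.sum_congr rfl this, Finset.sum_range_sub]
    simp only [g]
    rw [hF.iter_smul, mul_comm lam.den mu.den, hx.iter hF]
    simp only [sub_self, mul_zero, zpow_zero, Nat.cast_zero, sub_zero,
      Function.iterate_zero, id, smul_smul]
    rw [← sub_smul, ← hd]
    congr 1
    ring

theorem SS_top [FiniteDimensional LL N] (hF : SL p k F) (hb : Function.Bijective F) :
    SS p k F = ⊤ := by
  by_contra hne
  set S := SS p k F with hS
  have hnt : Nontrivial (N ⧸ S) := Submodule.Quotient.nontrivial_iff.2 hne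
  let G : N ⧸ S → N ⧸ S := fun q => Submodule.Quotient.mk (F (Quotient.out q))
  have hG : ∀ y : N, G (Submodule.Quotient.mk y) = Submodule.Quotient.mk (F y) := by
    intro y
    simp only [G]
    rw [Submodule.Quotient.eq, ← hF.sub]
    apply SS_F hF
    rw [← hS, ← Submodule.Quotient.eq]
    exact Quotient.out_eq _
  have hGSL : SL p k G := by
    constructor
    · intro x y
      obtain ⟨x, rfl⟩ := Submodule.Quotient.mk_surjective S x
      obtain ⟨y, rfl⟩ := Submodule.Quotient.mk_surjective S y
      rw [← Submodule.Quotient.mk_add, hG, hG, hG, hF.add, Submodule.Quotient.mk_add]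
    · intro c x
      obtain ⟨x, rfl⟩ := Submodule.Quotient.mk_surjective S x
      rw [← Submodule.Quotient.mk_smul, hG, hG, hF.smul, Submodule.Quotient.mk_smul]
  have hGinj : Function.Injective G := by
    intro x y h
    obtain ⟨x, rfl⟩ := Submodule.Quotient.mk_surjective S x
    obtain ⟨y, rfl⟩ := Submodule.Quotient.mk_surjective S y
    rw [hG, hG, Submodule.Quotient.eq, ← hF.sub] at h
    rw [Submodule.Quotient.eq]
    exact SS_F_inv hF hb h
  have hGi : ∀ (n : ℕ) (y : N), G^[n] (Submodule.Quotient.mk y) = Submodule.Quotient.mk (F^[n] y) := by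
    intro n y
    induction n with
    | zero => rfl
    | succ n ih => rw [Function.iterate_succ_apply', ih, hG, Function.iterate_succ_apply']
  obtain ⟨lam, x, hx, hlam⟩ := exists_eigen hGSL hGinj
  obtain ⟨y, rfl⟩ := Submodule.Quotient.mk_surjective S x
  rw [hGi, ← Submodule.Quotient.mk_smul, Submodule.Quotient.eq] at hlam
  obtain ⟨z, hz, hzeq⟩ := SS_op_surj (lam := lam) hF hlam
  apply hx
  rw [Submodule.Quotient.mk_eq_zero]
  have hyz : y - z ∈ S := by
    refine Submodule.subset_span ⟨lam, ?_⟩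
    rw [Eig, hF.iter_sub, smul_sub]
    rw [sub_eq_sub_iff_add_eq_add] at hzeq ⊢
    rw [← hzeq, add_comm]
  have := add_mem hyz hz
  rwa [sub_add_cancel] at this

theorem exists_orbit (hF : SL p k F) (hb : Function.Bijective F) {lam : ℚ} {x : N}
    (hx : Eig p k F lam x) : ∃ f : ℤ → N, f 0 = x ∧
      (∀ t m : ℤ, f (t + lam.den * m) = (p : LL) ^ m • f t) ∧ ∀ t, F (f t) = f (t + lam.num) := by
  let P : Equiv.Perm N := Equiv.ofBijective F hb
  have hP : ∀ y, P y = F y := fun y => rfl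
  have hPz : ∀ (m a : ℤ) (y : N), (P ^ m) ((p : LL) ^ a • y) = (p : LL) ^ a • (P ^ m) y := by
    intro m a y
    let Q : Equiv.Perm N := MulAction.toPerm (Units.mk0 ((p : LL) ^ a) (zpow_ne_zero a pne))
    have hQ : ∀ y, Q y = (p : LL) ^ a • y := fun y => rfl
    have hc : Commute P Q := by
      ext y
      simp only [Equiv.Perm.mul_apply, hP, hQ, hF.zpow]
    have := congrArg (fun R : Equiv.Perm N => R y) (hc.zpow_left m).eq
    simpa only [Equiv.Perm.mul_apply, hQ] using this
  have hPr : (P ^ (lam.den : ℤ)) x = (p : LL) ^ lam.num • x := by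
    rw [zpow_natCast, ← Equiv.Perm.iterate_eq_pow]
    exact hx
  have hPm : ∀ m : ℤ, (P ^ (lam.den * m : ℤ)) x = (p : LL) ^ (lam.num * m) • x := by
    intro m
    induction m using Int.induction_on with
    | zero => simp
    | succ i ih =>
      rw [mul_add, mul_one, zpow_add, Equiv.Perm.mul_apply, hPr, hPz, ih, smul_smul,
        ← zpow_add₀ pne]
      congr 2; ring
    | pred i ih =>
      have h1 : (P ^ ((lam.den : ℤ) * (-i))) x = (p : LL) ^ lam.num •
          (P ^ ((lam.den : ℤ) * (-i - 1))) x := by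
        rw [← hPz, ← hPr, ← Equiv.Perm.mul_apply, ← zpow_add]
        congr 2; ring
      rw [ih] at h1
      rw [show lam.num * (-(i : ℤ) - 1) = -lam.num + lam.num * (-i) by ring, zpow_add₀ pne,
        ← smul_smul, h1, smul_smul, ← zpow_add₀ pne, neg_add_cancel, zpow_zero, one_smul]
  have hco : IsCoprime lam.num (lam.den : ℤ) := by
    rw [Int.isCoprime_iff_gcd_eq_one]
    simpa [Int.gcd, Nat.Coprime] using lam.reduced
  obtain ⟨u, v, huv⟩ := hco
  refine ⟨fun t => (p : LL) ^ (v * t) • (P ^ (u * t)) x, by simp, ?_, ?_⟩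
  · intro t m
    beta_reduce
    rw [show u * (t + lam.den * m) = u * t + lam.den * (u * m) by ring, zpow_add,
      Equiv.Perm.mul_apply, hPm, hPz, smul_smul, smul_smul, ← zpow_add₀ pne, ← zpow_add₀ pne]
    congr 2
    linear_combination m * huv
  · intro t
    beta_reduce
    rw [hF.zpow, show u * (t + lam.num) = (1 + u * t) + lam.den * (-v) by
      linear_combination huv, zpow_add, Equiv.Perm.mul_apply, hPm, hPz, smul_smul,
      ← zpow_add₀ pne, zpow_add, Equiv.Perm.mul_apply, zpow_one, hP]
    congr 2
    ring

/-- Evaluation map. -/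
noncomputable def ev (r : ℕ) (f : ℤ → N) : (Fin r → LL) →ₗ[LL] N :=
  Fintype.linearCombination LL (fun j : Fin r => f (j : ℕ))

theorem ev_apply (r : ℕ) (f : ℤ → N) (a : Fin r → LL) :
    ev r f a = ∑ j : Fin r, a j • f (j : ℕ) := rfl

theorem ev_equiv (hF : SL p k F) {r : ℕ} {s : ℤ} {f : ℤ → N}
    (h1 : ∀ t m : ℤ, f (t + r * m) = (p : LL) ^ m • f t) (h2 : ∀ t, F (f t) = f (t + s))
    (a : Fin r → LL) : ev r f (slopeFrob p k r s a) = F (ev r f a) := by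
  obtain ⟨φ, e, hbij, he, hf⟩ := slope_index (p := p) (k := k) r s
  rw [ev_apply, ev_apply, hF.sum, ← (Equiv.ofBijective φ hbij).sum_comp (fun j => F (a j • f (j : ℕ)))]
  refine Finset.sum_congr rfl fun j _ => ?_
  rw [Equiv.ofBijective_apply, hF.smul, h2, he, hf, mul_comm, mul_smul, ← h1, add_comm]

theorem exists_decomp [FiniteDimensional LL N] (hF : SL p k F) (hb : Function.Bijective F) :
    ∃ (n : ℕ) (lam : Fin n → ℚ) (h : (∀ i : Fin n, Fin (lam i).den → LL) →ₗ[LL] N),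
      Function.Bijective h ∧ ∀ a, h (fun i => Nlam p k (lam i) (a i)) = F (h a) := by
  classical
  by_contra hcon
  have key : ∀ n : ℕ, ∃ (lam : Fin n → ℚ) (h : (∀ i : Fin n, Fin (lam i).den → LL) →ₗ[LL] N),
      Function.Injective h ∧ ∀ a, h (fun i => Nlam p k (lam i) (a i)) = F (h a) := by
    intro n
    induction n with
    | zero =>
      refine ⟨fun i => i.elim0, 0, fun a b _ => funext fun i => i.elim0, fun a => ?_⟩
      simp [hF.zero]
    | succ n ih =>
      obtain ⟨lam, h, hinj, heq⟩ := ih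
      have hr : LinearMap.range h ≠ ⊤ := fun htop =>
        hcon ⟨n, lam, h, ⟨hinj, LinearMap.range_eq_top.1 htop⟩, heq⟩
      obtain ⟨mu, x, hx, hxr⟩ : ∃ mu x, Eig p k F mu x ∧ x ∉ LinearMap.range h := by
        by_contra! hall
        apply hr
        rw [eq_top_iff, ← SS_top hF hb, SS, Submodule.span_le]
        rintro x ⟨mu, hx⟩
        exact hall mu x hx
      obtain ⟨f, hf0, hf1, hf2⟩ := exists_orbit hF hb hx
      have hev := ev_equiv hF hf1 hf2
      set E := ev (p := p) (k := k) mu.den f with hE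
      have hEx : ∃ a, E a = x := by
        refine ⟨Pi.single ⟨0, mu.pos⟩ 1, ?_⟩
        rw [hE, ev_apply, Finset.sum_eq_single ⟨0, mu.pos⟩]
        · simp [hf0]
        · intro j _ hj; rw [Pi.single_eq_of_ne hj, zero_smul]
        · simp
      have hbot : (LinearMap.range h).comap E = ⊥ := by
        refine (simple_part mu _ ?_).resolve_right ?_
        · rintro a ⟨b, hb⟩
          exact ⟨fun i => Nlam p k (lam i) (b i), by rw [heq, hb]; exact (hev a).symm⟩
        · intro htop
          obtain ⟨a, ha⟩ := hEx
          apply hxr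
          have : a ∈ (LinearMap.range h).comap E := by rw [htop]; trivial
          rwa [Submodule.mem_comap, ha] at this
      let lam' : Fin (n + 1) → ℚ := Fin.cons mu lam
      let pr0 : (∀ i : Fin (n + 1), Fin (lam' i).den → LL) →ₗ[LL] (Fin mu.den → LL) :=
        LinearMap.proj (φ := fun i : Fin (n + 1) => Fin (lam' i).den → LL) 0
      let pr1 : (∀ i : Fin (n + 1), Fin (lam' i).den → LL) →ₗ[LL]
          (∀ i : Fin n, Fin (lam i).den → LL) :=
        LinearMap.pi fun i => LinearMap.proj (φ := fun i : Fin (n + 1) => Fin (lam' i).den → LL) i.succ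
      refine ⟨lam', E ∘ₗ pr0 + h ∘ₗ pr1, ?_, ?_⟩
      · rw [← LinearMap.ker_eq_bot, LinearMap.ker_eq_bot']
        intro a ha
        rw [LinearMap.add_apply, LinearMap.comp_apply, LinearMap.comp_apply] at ha
        have h0 : pr0 a = 0 := by
          have : pr0 a ∈ (LinearMap.range h).comap E := by
            rw [Submodule.mem_comap, eq_neg_of_add_eq_zero_left ha]
            exact neg_mem ⟨_, rfl⟩
          rwa [hbot, Submodule.mem_bot] at this
        rw [h0, map_zero, zero_add] at ha
        have h1 : pr1 a = 0 := hinj (ha.trans (map_zero h).symm)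
        funext i
        induction i using Fin.cases with
        | zero => exact h0
        | succ i => exact congrFun h1 i
      · intro a
        rw [LinearMap.add_apply, LinearMap.comp_apply, LinearMap.comp_apply,
          LinearMap.add_apply, LinearMap.comp_apply, LinearMap.comp_apply, hF.add, ← heq]
        congr 1
        exact hev (pr0 a)
  obtain ⟨lam, h, hinj, -⟩ := key (Module.finrank LL N + 1)
  have h1 := LinearMap.finrank_le_finrank_of_injective hinj
  rw [Module.finrank_pi_fintype] at h1
  simp only [Module.finrank_fintype_fun_eq_card, Fintype.card_fin] at h1
  have h2 : ∑ i : Fin (Module.finrank LL N + 1), 1 ≤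
      ∑ i : Fin (Module.finrank LL N + 1), (lam i).den := Finset.sum_le_sum fun i _ => (lam i).pos
  simp only [Finset.sum_const, Finset.card_univ, Fintype.card_fin, smul_eq_mul, mul_one] at h2
  omega

theorem decomp_part [FiniteDimensional LL N] (hF : SL p k F) (hb : Function.Bijective F) :
    ∃ (n : ℕ) (lam : Fin n → ℚ) (g : N ≃ₗ[LL] (∀ i : Fin n, Fin (lam i).den → LL)),
      ∀ x : N, g (F x) = fun i => Nlam p k (lam i) (g x i) := by
  obtain ⟨n, lam, h, hbij, heq⟩ := exists_decomp hF hb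
  refine ⟨n, lam, (LinearEquiv.ofBijective h hbij).symm, fun x => ?_⟩
  rw [LinearEquiv.symm_apply_eq]
  refine Eq.trans ?_ (heq _).symm
  congr 1
  exact ((LinearEquiv.ofBijective h hbij).apply_symm_apply x).symm

end ex2sec

section uniqsec

variable {p : ℕ} [Fact p.Prime] {k : Type*} [Field k] [IsAlgClosed k] [CharP k p]

/-- The fraction field. -/
local notation "LL" => FractionRing (WittVector p k)

variable {N : Type*} [AddCommGroup N] [Module (FractionRing (WittVector p k)) N] {F : N → N}

theorem Nlam_iter_zero (mu : ℚ) (m : ℕ) : (Nlam p k mu)^[m] 0 = 0 := by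
  induction m with
  | zero => rfl
  | succ m ih =>
    rw [Function.iterate_succ_apply', ih]
    funext j
    simp [Nlam, slopeFrob]

theorem g_iter {n : ℕ} {lam : Fin n → ℚ} {g : N ≃ₗ[LL] (∀ i : Fin n, Fin (lam i).den → LL)}
    (hg : ∀ x : N, g (F x) = fun i => Nlam p k (lam i) (g x i)) (m : ℕ) (x : N) (i : Fin n) :
    g (F^[m] x) i = (Nlam p k (lam i))^[m] (g x i) := by
  induction m with
  | zero => rfl
  | succ m ih =>
    rw [Function.iterate_succ_apply', hg, Function.iterate_succ_apply', ← ih]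

theorem eig_single {n : ℕ} {lam : Fin n → ℚ} {g : N ≃ₗ[LL] (∀ i : Fin n, Fin (lam i).den → LL)}
    (hg : ∀ x : N, g (F x) = fun i => Nlam p k (lam i) (g x i)) (i : Fin n)
    (j : Fin (lam i).den) : Eig p k F (lam i) (g.symm (Pi.single i (Pi.single j 1))) := by
  rw [Eig]
  apply g.injective
  funext i'
  rw [g_iter hg, map_smul, g.apply_symm_apply, Pi.smul_apply]
  by_cases h : i' = i
  · subst h
    rw [Pi.single_eq_same]
    exact EE_eigen _ _
  · rw [Pi.single_eq_of_ne h, smul_zero]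
    exact Nlam_iter_zero _ _

theorem finrank_eig {n : ℕ} {lam : Fin n → ℚ}
    {g : N ≃ₗ[LL] (∀ i : Fin n, Fin (lam i).den → LL)}
    (hg : ∀ x : N, g (F x) = fun i => Nlam p k (lam i) (g x i)) (mu : ℚ) :
    Module.finrank LL (Submodule.span LL {x | Eig p k F mu x}) =
      Fintype.card {i // lam i = mu} * mu.den := by
  classical
  let E := Submodule.span LL {x | Eig p k F mu x}
  let π : N →ₗ[LL] (∀ i : {i // lam i = mu}, Fin (lam i.1).den → LL) :=
    LinearMap.pi fun i => LinearMap.proj (φ := fun i : Fin n => Fin (lam i).den → LL) i.1 ∘ₗ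
      g.toLinearMap
  have hπ : ∀ x i, π x i = g x i.1 := fun x i => rfl
  have hvan : ∀ x ∈ E, ∀ i, lam i ≠ mu → g x i = 0 := by
    intro x hx i hi
    induction hx using Submodule.span_induction with
    | mem x hx =>
      by_contra hne
      apply hi
      apply eigen_slope (p := p) (k := k) hne
      have hx' : F^[mu.den] x = (p : LL) ^ mu.num • x := hx
      rw [← g_iter hg, hx', map_smul, Pi.smul_apply]
    | zero => simp
    | add x y _ _ h1 h2 => rw [map_add, Pi.add_apply, h1, h2, add_zero]
    | smul c x _ h => rw [map_smul, Pi.smul_apply, h, smul_zero]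
  have hinj : Function.Injective (π.domRestrict E) := by
    rw [← LinearMap.ker_eq_bot, LinearMap.ker_eq_bot']
    rintro ⟨x, hx⟩ h0
    rw [LinearMap.domRestrict_apply] at h0
    have : g x = 0 := by
      funext i
      by_cases h : lam i = mu
      · exact congrFun h0 ⟨i, h⟩
      · exact hvan x hx i h
    ext
    exact (map_eq_zero_iff g g.injective).1 this
  have hmem : ∀ i, lam i = mu → ∀ w : Fin (lam i).den → LL, g.symm (Pi.single i w) ∈ E := by
    rintro i rfl w
    have hw : w = ∑ j, w j • Pi.single j (1 : LL) := by
      rw [← Finset.univ_sum_single w]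
      refine Finset.sum_congr rfl fun j _ => ?_
      rw [Finset.univ_sum_single w, ← Pi.single_smul, smul_eq_mul, mul_one]
    have h2 : Pi.single (M := fun i : Fin n => Fin (lam i).den → LL) i w =
        ∑ j, w j • Pi.single (M := fun i : Fin n => Fin (lam i).den → LL) i
          (Pi.single j (1 : LL)) := by
      have h3 := congrArg (LinearMap.single LL (fun i : Fin n => Fin (lam i).den → LL) i) hw
      rw [map_sum] at h3
      simpa only [map_smul, LinearMap.coe_single] using h3
    rw [h2, map_sum]
    refine sum_mem fun j _ => ?_
    rw [map_smul]
    exact Submodule.smul_mem _ _ (Submodule.subset_span (eig_single hg i j))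
  have hsurj : Function.Surjective (π.domRestrict E) := by
    intro b
    let v : ∀ i : Fin n, Fin (lam i).den → LL := fun i => if h : lam i = mu then b ⟨i, h⟩ else 0
    have hv : g.symm v ∈ E := by
      rw [← Finset.univ_sum_single v, map_sum]
      refine sum_mem fun i _ => ?_
      by_cases h : lam i = mu
      · exact hmem i h _
      · have : v i = 0 := dif_neg h
        rw [this, Pi.single_zero, map_zero]
        exact zero_mem _
    refine ⟨⟨g.symm v, hv⟩, ?_⟩
    funext i
    rw [LinearMap.domRestrict_apply, hπ, g.apply_symm_apply]
    exact dif_pos i.2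
  rw [(LinearEquiv.ofBijective _ ⟨hinj, hsurj⟩).finrank_eq, Module.finrank_pi_fintype]
  simp only [Module.finrank_fintype_fun_eq_card, Fintype.card_fin]
  rw [Finset.sum_congr rfl (fun (i : {i // lam i = mu}) _ => congrArg Rat.den i.2)]
  simp

theorem uniq_part {n n' : ℕ} {lam : Fin n → ℚ} {lam' : Fin n' → ℚ}
    {g : N ≃ₗ[LL] (∀ i : Fin n, Fin (lam i).den → LL)}
    {g' : N ≃ₗ[LL] (∀ i : Fin n', Fin (lam' i).den → LL)}
    (hg : ∀ x : N, g (F x) = fun i => Nlam p k (lam i) (g x i))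
    (hg' : ∀ x : N, g' (F x) = fun i => Nlam p k (lam' i) (g' x i)) :
    ∃ e : Fin n' ≃ Fin n, lam' = lam ∘ e := by
  have h : ∀ mu : ℚ, Nonempty ({i // lam' i = mu} ≃ {i // lam i = mu}) := by
    intro mu
    rw [← Fintype.card_eq]
    have := (finrank_eig hg' mu).symm.trans (finrank_eig hg mu)
    exact Nat.eq_of_mul_eq_mul_right mu.pos this
  let q : ∀ mu : ℚ, {i // lam' i = mu} ≃ {i // lam i = mu} := fun mu => (h mu).some
  refine ⟨(Equiv.sigmaFiberEquiv lam').symm.trans ((Equiv.sigmaCongrRight q).trans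
    (Equiv.sigmaFiberEquiv lam)), ?_⟩
  funext i
  exact (q (lam' i) ⟨i, rfl⟩).2.symm

end uniqsec

end DM

/-- Manin–Dieudonné classification: over an algebraically closed field `k`
of characteristic `p`, (1) each `N^λ_k` is a simple F-space; (2) every F-space
(finite-dimensional `L`-vector space `N` with a bijective `σ`-semilinear `F`) is
isomorphic to a finite direct sum `⊕ᵢ N^{λᵢ}_k`; (3) the multiset of slopes is uniquely
determined. -/
theorem stmt14 (p : ℕ) [Fact p.Prime] (k : Type*) [Field k] [IsAlgClosed k] [CharP k p] :
    -- (1) simplicity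
    (∀ lam : ℚ, ∀ U : Submodule (FractionRing (WittVector p k))
        (Fin lam.den → FractionRing (WittVector p k)),
      (∀ x ∈ U, Nlam p k lam x ∈ U) → U = ⊥ ∨ U = ⊤) ∧
    -- (2) existence of the decomposition
    (∀ (N : Type) [AddCommGroup N] [Module (FractionRing (WittVector p k)) N]
        [FiniteDimensional (FractionRing (WittVector p k)) N] (F : N → N),
      (∀ x y, F (x + y) = F x + F y) →
      (∀ (c : FractionRing (WittVector p k)) (x : N),
        F (c • x) = fracWittFrobenius p k c • F x) →
      Function.Bijective F →
      ∃ (n : ℕ) (lam : Fin n → ℚ)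
        (g : N ≃ₗ[FractionRing (WittVector p k)]
          (∀ i : Fin n, Fin (lam i).den → FractionRing (WittVector p k))),
        ∀ x : N, g (F x) = fun i => Nlam p k (lam i) (g x i)) ∧
    -- (3) uniqueness of the multiplicities
    (∀ (N : Type) [AddCommGroup N] [Module (FractionRing (WittVector p k)) N]
        [FiniteDimensional (FractionRing (WittVector p k)) N] (F : N → N)
      (n n' : ℕ) (lam : Fin n → ℚ) (lam' : Fin n' → ℚ)
      (g : N ≃ₗ[FractionRing (WittVector p k)]
        (∀ i : Fin n, Fin (lam i).den → FractionRing (WittVector p k)))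
      (g' : N ≃ₗ[FractionRing (WittVector p k)]
        (∀ i : Fin n', Fin (lam' i).den → FractionRing (WittVector p k))),
      (∀ x : N, g (F x) = fun i => Nlam p k (lam i) (g x i)) →
      (∀ x : N, g' (F x) = fun i => Nlam p k (lam' i) (g' x i)) →
      ∃ e : Fin n' ≃ Fin n, lam' = lam ∘ e) := by
  refine ⟨fun lam U hU => DM.simple_part lam U hU, ?_, ?_⟩
  · intro N _ _ _ F hadd hsmul hb
    exact DM.decomp_part ⟨hadd, hsmul⟩ hb
  · intro N _ _ _ F n n' lam lam' g g' hg hg'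
    exact DM.uniq_part hg hg'
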